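/- arXiv:1505.01970 — 2 statements merged into one kernel-verified Lean document; each statement's English description precedes it below -/
import Mathlib

section
/- Let q be an odd prime power, let r ≥ 2 and n ≥ 2 be integers, let α_1, …, α_r ∈ 𝔽_q[T] be distinct polynomials with deg α_j < n, and let ε_1, …, ε_r ∈ {1,2} be not all even. Then |∑_{f ∈ M_n} μ(f+α_1)^{ε_1} ⋯ μ(f+α_r)^{ε_r}| ≤ 2rn·q^{n−1/2} + 3rn^2·q^{n−1}. -/
open Polynomial

/-- The monic polynomial of degree `n` determined by its lower-order coefficients `a`.
As `a` ranges over `Fin n → F` this parameterizes the set `Mₙ` of monic polynomials of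
degree `n` in `F[X]`. -/
noncomputable def mon {F : Type} [Field F] (n : ℕ) (a : Fin n → F) : F[X] :=
  X ^ n + ∑ i : Fin n, C (a i) * X ^ (i : ℕ)

open Classical in
/-- The Möbius function on `F[X]`: `μ(f) = (−1)^r` if `f` is a (nonzero scalar multiple
of a) product of `r` distinct monic irreducible polynomials, and `μ(f) = 0` if `f` is
not squarefree. -/
noncomputable def mu {F : Type} [Field F] (f : F[X]) : ℝ :=
  if Squarefree f then
    (-1 : ℝ) ^ Multiset.card (UniqueFactorizationMonoid.normalizedFactors f)
  else 0

namespace Polynomial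

theorem pow_dvd_hasseDeriv_pow_mul {R : Type*} [CommRing R] (P h : R[X]) (M k : ℕ) :
    P ^ (M - k) ∣ hasseDeriv k (P ^ M * h) := by
  induction M generalizing k with
  | zero => simp
  | succ M ih =>
    rw [pow_succ', mul_assoc, hasseDeriv_mul]
    refine Finset.dvd_sum fun ij hij => ?_
    rw [Finset.HasAntidiagonal.mem_antidiagonal] at hij
    rcases Nat.eq_zero_or_pos ij.1 with h0 | h0
    · rw [h0, hasseDeriv_zero']
      refine dvd_trans (pow_dvd_pow P (show M + 1 - k ≤ (M - ij.2) + 1 by omega)) ?_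
      rw [pow_succ']
      exact mul_dvd_mul_left _ (ih _)
    · exact Dvd.dvd.mul_left ((pow_dvd_pow P (by omega)).trans (ih ij.2)) _

theorem hasseDeriv_expand_eq_zero {R : Type*} [CommRing R] (p e : ℕ) [Fact p.Prime] [CharP R p]
    (h : R[X]) {k : ℕ} (hk : 0 < k) (hkq : k < p ^ e) :
    hasseDeriv k (expand R (p ^ e) h) = 0 := by
  have : ExpChar R p := ExpChar.prime Fact.out
  have hq : 0 < p ^ e := by omega
  induction h using Polynomial.induction_on' with
  | add f g hf hg => rw [map_add, map_add, hf, hg, add_zero]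
  | monomial n a =>
    rw [expand_monomial, hasseDeriv_monomial]
    have : ((p ^ e * n).choose k : R) = 0 := by
      rw [← coeff_X_add_one_pow R (p ^ e * n) k, pow_mul, add_pow_expChar_pow, one_pow]
      have : ((X : R[X]) ^ p ^ e + 1) ^ n = expand R (p ^ e) ((X + 1) ^ n) := by simp
      rw [this, coeff_expand hq, if_neg]
      exact fun hd => absurd (Nat.le_of_dvd hk hd) (by omega)
    rw [mul_comm n, this, zero_mul, monomial_zero_right]

theorem hasseDeriv_mul_expand {R : Type*} [CommRing R] (p e : ℕ) [Fact p.Prime] [CharP R p]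
    (f h : R[X]) {k : ℕ} (hkq : k < p ^ e) :
    hasseDeriv k (f * expand R (p ^ e) h) = hasseDeriv k f * expand R (p ^ e) h := by
  rw [hasseDeriv_mul, Finset.sum_eq_single (k, 0)]
  · simp
  · intro ij hij hne
    rw [Finset.HasAntidiagonal.mem_antidiagonal] at hij
    rw [hasseDeriv_expand_eq_zero p e h, mul_zero]
    · rcases Nat.eq_zero_or_pos ij.2 with h0 | h0
      · exact absurd (Prod.ext (by simpa [h0] using hij) h0) hne
      · exact h0
    · omega
  · simp

theorem X_sub_C_pow_dvd_of_hasseDeriv {R : Type*} [CommRing R] (f : R[X]) (x : R) (l : ℕ)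
    (h : ∀ k < l, (hasseDeriv k f).eval x = 0) : (X - C x) ^ l ∣ f := by
  have h1 : X ^ l ∣ taylor x f := by
    rw [X_pow_dvd_iff]
    intro k hk
    rw [taylor_coeff, h k hk]
  have h2 := _root_.map_dvd (taylorAlgHom (-x)) h1
  change taylor (-x) (X ^ l) ∣ taylor (-x) (taylor x f) at h2
  rw [taylor_taylor, neg_add_cancel, taylor_zero, taylor_pow, taylor_X] at h2
  simpa [sub_eq_add_neg] using h2

theorem card_mul_le_natDegree_of_pow_dvd {F : Type*} [Field F] (f : F[X]) (hf : f ≠ 0) (l : ℕ)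
    (s : Finset F) (h : ∀ x ∈ s, (X - C x) ^ l ∣ f) : s.card * l ≤ f.natDegree := by
  have h1 : (∏ x ∈ s, (X - C x) ^ l) ∣ f := by
    refine Finset.prod_dvd_of_coprime ?_ h
    intro x _ y _ hxy
    exact IsCoprime.pow (isCoprime_X_sub_C_of_isUnit_sub (sub_ne_zero.2 hxy).isUnit)
  have h2 := natDegree_le_of_dvd h1 hf
  rw [natDegree_prod_of_monic _ _ (fun x _ => (monic_X_sub_C x).pow l)] at h2
  simpa [natDegree_pow] using h2

/-- A polynomial with a simple root in an extension is not a constant times a ratio of squares. -/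
theorem eq_zero_of_simple_root {F K : Type*} [Field F] [Field K] (φ : F →+* K)
    {P r s : F[X]} (c : F) (β : K) (h0 : P.eval₂ φ β = 0) (h1 : (derivative P).eval₂ φ β ≠ 0)
    (h : P * r ^ 2 = C c * s ^ 2) : r = 0 := by
  by_contra hr
  have hP : P ≠ 0 := by rintro rfl; simp at h1
  have hcs : C c * s ^ 2 ≠ 0 := h ▸ mul_ne_zero hP (pow_ne_zero _ hr)
  have hc : c ≠ 0 := by rintro rfl; simp at hcs
  have hs : s ≠ 0 := by rintro rfl; simp at hcs
  have inj := map_injective φ φ.injective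
  have hP' : P.map φ ≠ 0 := (Polynomial.map_ne_zero_iff φ.injective).2 hP
  have hr' : r.map φ ≠ 0 := (Polynomial.map_ne_zero_iff φ.injective).2 hr
  have hs' : s.map φ ≠ 0 := (Polynomial.map_ne_zero_iff φ.injective).2 hs
  have hm : rootMultiplicity β (P.map φ) = 1 := by
    rw [eval₂_eq_eval_map] at h0 h1
    have hpos : 0 < rootMultiplicity β (P.map φ) := (rootMultiplicity_pos hP').2 h0
    have := (one_lt_rootMultiplicity_iff_isRoot (t := β) hP').not.2 (by
      rintro ⟨_, h2⟩
      rw [derivative_map] at h2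
      exact h1 h2)
    omega
  have e := congrArg (fun f => rootMultiplicity β (f.map φ)) h
  simp only [Polynomial.map_mul, Polynomial.map_pow, map_C] at e
  rw [rootMultiplicity_mul (mul_ne_zero hP' (pow_ne_zero _ hr')),
    rootMultiplicity_mul (mul_ne_zero (by simpa using hc) (pow_ne_zero _ hs')),
    rootMultiplicity_C, hm] at e
  have sq : ∀ f : K[X], f ≠ 0 → rootMultiplicity β (f ^ 2) = 2 * rootMultiplicity β f := by
    intro f hf
    rw [pow_two, rootMultiplicity_mul (mul_ne_zero hf hf)]; ring
  rw [sq _ hr', sq _ hs'] at e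
  omega

section Stepanov

variable {F : Type*} [Field F]

theorem exists_hasseDeriv_pow_mul_eq (P f : F[X]) (M k B : ℕ) (hk : k ≤ M)
    (hP : 1 ≤ P.natDegree) (hf : f.natDegree ≤ B) :
    ∃ T : F[X], hasseDeriv k (P ^ M * f) = P ^ (M - k) * T ∧
      T.natDegree ≤ B + k * (P.natDegree - 1) := by
  obtain ⟨T, hT⟩ := pow_dvd_hasseDeriv_pow_mul P f M k
  refine ⟨T, hT, ?_⟩
  rcases eq_or_ne T 0 with rfl | hT0
  · simp
  have hP0 : P ≠ 0 := by rintro rfl; simp at hP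
  have h1 := natDegree_hasseDeriv_le (P ^ M * f) k
  have h2 : (P ^ M * f).natDegree ≤ M * P.natDegree + B :=
    natDegree_mul_le_of_le natDegree_pow_le hf
  rw [hT, natDegree_mul (pow_ne_zero _ hP0) hT0, natDegree_pow] at h1
  obtain ⟨d, hd⟩ : ∃ d, P.natDegree = d + 1 := ⟨P.natDegree - 1, by omega⟩
  obtain ⟨m, rfl⟩ : ∃ m, M = k + m := ⟨M - k, by omega⟩
  rw [hd] at *
  simp only [Nat.add_sub_cancel_left, Nat.add_sub_cancel] at *
  have e : (k + m) * (d + 1) = k * d + k + m * (d + 1) := by ring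
  omega

/-- The `k`-th linear condition in Stepanov's method. -/
noncomputable def stepanovMap (P : F[X]) (c l B J k : ℕ) :
    ((Fin J → degreeLT F (B + 1)) × (Fin J → degreeLT F (B + 1))) →ₗ[F] F[X] :=
  ∑ j : Fin J, LinearMap.mulLeft F (X ^ (j : ℕ)) ∘ₗ
    (LinearMap.mulLeft F (P ^ c) ∘ₗ hasseDeriv k ∘ₗ LinearMap.mulLeft F (P ^ l) ∘ₗ
        (degreeLT F (B + 1)).subtype ∘ₗ LinearMap.proj j ∘ₗ LinearMap.fst F _ _ +
      hasseDeriv k ∘ₗ LinearMap.mulLeft F (P ^ (l + c)) ∘ₗ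
        (degreeLT F (B + 1)).subtype ∘ₗ LinearMap.proj j ∘ₗ LinearMap.snd F _ _)

theorem stepanovMap_apply (P : F[X]) (c l B J k : ℕ)
    (v : (Fin J → degreeLT F (B + 1)) × (Fin J → degreeLT F (B + 1))) :
    stepanovMap P c l B J k v = ∑ j : Fin J, X ^ (j : ℕ) *
      (P ^ c * hasseDeriv k (P ^ l * (v.1 j : F[X])) +
        hasseDeriv k (P ^ (l + c) * (v.2 j : F[X]))) := by
  simp [stepanovMap]

theorem natDegree_le_of_mem_degreeLT_succ {R : Type*} [Semiring R] {B : ℕ} {f : R[X]}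
    (h : f ∈ degreeLT R (B + 1)) : f.natDegree ≤ B := by
  rw [mem_degreeLT] at h
  rw [natDegree_le_iff_degree_le]
  exact Order.lt_succ_iff.1 h

theorem stepanovMap_mem (P : F[X]) (c l B J k : ℕ) (hP : 1 ≤ P.natDegree) (hk : k ≤ l)
    (v : (Fin J → degreeLT F (B + 1)) × (Fin J → degreeLT F (B + 1))) :
    stepanovMap P c l B J k v ∈ (degreeLT F (B + k * (P.natDegree - 1) + J)).map
      (LinearMap.mulLeft F (P ^ (l + c - k))) := by
  rw [stepanovMap_apply]
  refine Submodule.sum_mem _ fun j _ => ?_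
  obtain ⟨T, hT, hTd⟩ := exists_hasseDeriv_pow_mul_eq P (v.1 j : F[X]) l k B hk hP
    (natDegree_le_of_mem_degreeLT_succ (v.1 j).2)
  obtain ⟨S, hS, hSd⟩ := exists_hasseDeriv_pow_mul_eq P (v.2 j : F[X]) (l + c) k B (by omega) hP
    (natDegree_le_of_mem_degreeLT_succ (v.2 j).2)
  refine ⟨X ^ (j : ℕ) * (T + S), ?_, ?_⟩
  · have h1 : (X ^ (j : ℕ) * (T + S)).natDegree ≤ j + (B + k * (P.natDegree - 1)) :=
      natDegree_mul_le_of_le (natDegree_X_pow_le _) (natDegree_add_le_of_degree_le hTd hSd)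
    have hj := j.2
    rw [SetLike.mem_coe, mem_degreeLT]
    refine degree_le_natDegree.trans_lt ?_
    exact_mod_cast lt_of_le_of_lt h1 (by omega)
  · rw [hT, hS, LinearMap.mulLeft_apply, show l + c - k = c + (l - k) by omega, pow_add]
    ring

theorem finrank_degreeLT (F : Type*) [Field F] (n : ℕ) : Module.finrank F (degreeLT F n) = n := by
  rw [(degreeLTEquiv F n).finrank_eq]; simp

theorem exists_stepanovMap_eq_zero (P : F[X]) (c l B J : ℕ) (hP : 1 ≤ P.natDegree)
    (h : ∑ k ∈ Finset.range l, (B + k * (P.natDegree - 1) + J) < 2 * (J * (B + 1))) :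
    ∃ v, v ≠ 0 ∧ ∀ k < l, stepanovMap P c l B J k v = 0 := by
  let W : Fin l → Submodule F F[X] := fun k =>
    (degreeLT F (B + k * (P.natDegree - 1) + J)).map (LinearMap.mulLeft F (P ^ (l + c - k)))
  let L : ((Fin J → degreeLT F (B + 1)) × (Fin J → degreeLT F (B + 1))) →ₗ[F]
      (∀ k : Fin l, W k) :=
    LinearMap.pi fun k => (stepanovMap P c l B J k).codRestrict (W k)
      fun v => stepanovMap_mem P c l B J k hP k.2.le v
  have hW : ∀ k, Module.finrank F (W k) ≤ B + k * (P.natDegree - 1) + J := fun k =>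
    (Submodule.finrank_map_le _ _).trans (finrank_degreeLT F _).le
  have hfin : Module.finrank F (∀ k : Fin l, W k) <
      Module.finrank F ((Fin J → degreeLT F (B + 1)) × (Fin J → degreeLT F (B + 1))) := by
    rw [Module.finrank_pi_fintype, Module.finrank_prod, Module.finrank_pi_fintype]
    simp only [finrank_degreeLT, Finset.sum_const, Finset.card_univ, Fintype.card_fin, smul_eq_mul]
    refine (Finset.sum_le_sum fun k _ => hW k).trans_lt ?_
    rw [Fin.sum_univ_eq_sum_range (fun k => B + k * (P.natDegree - 1) + J) l]
    omega
  obtain ⟨v, hv, hv0⟩ := Submodule.exists_mem_ne_zero_of_ne_bot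
    (LinearMap.ker_ne_bot_of_finrank_lt (f := L) hfin)
  refine ⟨v, hv0, fun k hk => ?_⟩
  have := congrFun (LinearMap.mem_ker.1 hv) ⟨k, hk⟩
  exact congrArg Subtype.val this

variable [Fintype F]

theorem hasseDeriv_mul_expand_card (f h : F[X]) {k : ℕ} (hk : k < Fintype.card F) :
    hasseDeriv k (f * expand F (Fintype.card F) h) =
      hasseDeriv k f * expand F (Fintype.card F) h := by
  obtain ⟨p, hp⟩ := CharP.exists F
  obtain ⟨e, hpp, he⟩ := FiniteField.card F p
  have : Fact p.Prime := ⟨hpp⟩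
  rw [he] at hk ⊢
  exact hasseDeriv_mul_expand p e f h hk

theorem X_pow_card_dvd_pow_card_sub (P : F[X]) :
    X ^ Fintype.card F ∣ P ^ Fintype.card F - C (P.eval 0) := by
  have h : X ∣ P - C (P.eval 0) := by
    rw [X_dvd_iff]; simp [coeff_zero_eq_eval_zero]
  have h2 := _root_.map_dvd (expand F (Fintype.card F)) h
  rwa [map_sub, expand_X, expand_C, FiniteField.expand_card] at h2

/-- The functions `r j + P ^ c * s j` with `r j`, `s j` of small degree are linearly independent
over the polynomials in `X ^ q`. -/
theorem eq_zero_of_sum_expand_eq_zero {K : Type*} [Field K] (φ : F →+* K) {P : F[X]} {c : ℕ}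
    (hc : Fintype.card F = 2 * c + 1) (β : K) (h0 : P.eval₂ φ β = 0)
    (h1 : (derivative P).eval₂ φ β ≠ 0) (hP0 : P.eval 0 ≠ 0) (B : ℕ)
    (hB : 2 * B + P.natDegree < Fintype.card F) (J : ℕ) (r s : ℕ → F[X])
    (hr : ∀ j, (r j).natDegree ≤ B) (hs : ∀ j, (s j).natDegree ≤ B)
    (h : ∑ j ∈ Finset.range J, (r j + P ^ c * s j) * X ^ (Fintype.card F * j) = 0) :
    ∀ j < J, r j = 0 ∧ s j = 0 := by
  set q := Fintype.card F with hq
  induction J generalizing r s with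
  | zero => intro j hj; omega
  | succ J ih =>
    have hsplit : ∑ j ∈ Finset.range (J + 1), (r j + P ^ c * s j) * X ^ (q * j) =
        X ^ q * (∑ j ∈ Finset.range J, (r (j + 1) + P ^ c * s (j + 1)) * X ^ (q * j)) +
          (r 0 + P ^ c * s 0) := by
      rw [Finset.sum_range_succ', Finset.mul_sum]
      congr 1
      · refine Finset.sum_congr rfl fun j _ => ?_
        ring
      · simp
    rw [hsplit] at h
    have hd : X ^ q ∣ r 0 + P ^ c * s 0 := by
      rw [(neg_eq_of_add_eq_zero_right h).symm]
      exact (dvd_mul_right _ _).neg_right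
    have hd2 : X ^ q ∣ P * r 0 ^ 2 - C (P.eval 0) * s 0 ^ 2 := by
      have e : P * r 0 ^ 2 - C (P.eval 0) * s 0 ^ 2 =
          (r 0 + P ^ c * s 0) * (P * (r 0 - P ^ c * s 0)) +
            (P ^ q - C (P.eval 0)) * s 0 ^ 2 := by
        rw [hc]; ring
      rw [e]
      exact dvd_add (hd.mul_right _) ((X_pow_card_dvd_pow_card_sub P).mul_right _)
    have hz : P * r 0 ^ 2 - C (P.eval 0) * s 0 ^ 2 = 0 := by
      by_contra hne
      have h3 := natDegree_le_of_dvd hd2 hne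
      rw [natDegree_X_pow] at h3
      have h4 : (P * r 0 ^ 2).natDegree ≤ P.natDegree + 2 * B :=
        natDegree_mul_le_of_le le_rfl (natDegree_pow_le_of_le 2 (hr 0))
      have h5 : (C (P.eval 0) * s 0 ^ 2).natDegree ≤ 2 * B :=
        (natDegree_C_mul_le _ _).trans (natDegree_pow_le_of_le 2 (hs 0))
      have := natDegree_sub_le_of_le h4 h5
      omega
    rw [sub_eq_zero] at hz
    have r0 : r 0 = 0 := eq_zero_of_simple_root φ _ β h0 h1 hz
    have s0 : s 0 = 0 := by
      rw [r0] at hz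
      simpa [hP0] using hz.symm
    rw [r0, s0] at h
    have h6 : ∑ j ∈ Finset.range J, (r (j + 1) + P ^ c * s (j + 1)) * X ^ (q * j) = 0 := by
      simpa using h
    have h7 := ih (fun j => r (j + 1)) (fun j => s (j + 1)) (fun j => hr _) (fun j => hs _) h6
    rintro (_ | j) hj
    · exact ⟨r0, s0⟩
    · exact h7 j (by omega)

open Classical in
/-- Stepanov's bound for the number of `x` with `P x` zero or a `c`-th root of unity. -/
theorem card_mul_le_of_stepanov {K : Type*} [Field K] (φ : F →+* K) {P : F[X]} {c : ℕ}
    (hc : Fintype.card F = 2 * c + 1) (β : K) (h0 : P.eval₂ φ β = 0)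
    (h1 : (derivative P).eval₂ φ β ≠ 0) (hP0 : P.eval 0 ≠ 0) (l B J : ℕ)
    (hl : l ≤ Fintype.card F)
    (hB : 2 * B + P.natDegree < Fintype.card F)
    (h : ∑ k ∈ Finset.range l, (B + k * (P.natDegree - 1) + (J + 1)) < 2 * ((J + 1) * (B + 1))) :
    (Finset.univ.filter fun x : F => P.eval x = 0 ∨ P.eval x ^ c = 1).card * l ≤
      (l + c) * P.natDegree + B + Fintype.card F * J := by
  have hP : 1 ≤ P.natDegree := by
    by_contra hcon
    rw [eq_C_of_natDegree_eq_zero (show P.natDegree = 0 by omega)] at h1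
    simp at h1
  obtain ⟨v, hv0, hv⟩ := exists_stepanovMap_eq_zero P c l B (J + 1) hP h
  set q := Fintype.card F with hq
  let r : ℕ → F[X] := fun j => if hj : j < J + 1 then (v.1 ⟨j, hj⟩ : F[X]) else 0
  let s : ℕ → F[X] := fun j => if hj : j < J + 1 then (v.2 ⟨j, hj⟩ : F[X]) else 0
  have hrv : ∀ j : Fin (J + 1), r j = v.1 j := fun j => dif_pos j.2
  have hr : ∀ j, (r j).natDegree ≤ B := by
    intro j
    by_cases hj : j < J + 1
    · rw [hrv ⟨j, hj⟩]
      exact natDegree_le_of_mem_degreeLT_succ (v.1 ⟨j, hj⟩).2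
    · rw [show r j = 0 from dif_neg hj, natDegree_zero]
      exact Nat.zero_le _
  have hsv : ∀ j : Fin (J + 1), s j = v.2 j := fun j => dif_pos j.2
  have hs : ∀ j, (s j).natDegree ≤ B := by
    intro j
    by_cases hj : j < J + 1
    · rw [hsv ⟨j, hj⟩]
      exact natDegree_le_of_mem_degreeLT_succ (v.2 ⟨j, hj⟩).2
    · rw [show s j = 0 from dif_neg hj, natDegree_zero]
      exact Nat.zero_le _
  have hv' : ∀ k < l, ∑ j ∈ Finset.range (J + 1), X ^ j *
      (P ^ c * hasseDeriv k (P ^ l * r j) + hasseDeriv k (P ^ (l + c) * s j)) = 0 := by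
    intro k hk
    have := hv k hk
    rw [stepanovMap_apply] at this
    rw [Finset.sum_range, ← this]
    refine Finset.sum_congr rfl fun j _ => ?_
    rw [hrv, hsv]
  set Ψ := ∑ j ∈ Finset.range (J + 1), (r j + P ^ c * s j) * X ^ (q * j) with hΨ
  have hΨ0 : Ψ ≠ 0 := by
    intro hz
    have hz' := eq_zero_of_sum_expand_eq_zero φ hc β h0 h1 hP0 B hB (J + 1) r s hr hs hz
    apply hv0
    have e1 : v.1 = 0 := by
      refine _root_.funext fun j => Subtype.ext ?_
      simpa [hrv] using (hz' j j.2).1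
    have e2 : v.2 = 0 := by
      refine _root_.funext fun j => Subtype.ext ?_
      simpa [hsv] using (hz' j j.2).2
    exact Prod.ext e1 e2
  have hPne : P ≠ 0 := by rintro rfl; simp at hP
  have hΦ0 : P ^ l * Ψ ≠ 0 := mul_ne_zero (pow_ne_zero _ hPne) hΨ0
  have hΦ : P ^ l * Ψ = ∑ j ∈ Finset.range (J + 1),
      (P ^ l * r j + P ^ (l + c) * s j) * expand F q (X ^ j) := by
    rw [hΨ, Finset.mul_sum]
    refine Finset.sum_congr rfl fun j _ => ?_
    rw [map_pow, expand_X]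
    ring
  refine (card_mul_le_natDegree_of_pow_dvd (P ^ l * Ψ) hΦ0 l _ ?_).trans ?_
  · intro x hx
    refine X_sub_C_pow_dvd_of_hasseDeriv _ _ _ fun k hk => ?_
    have hx' : P.eval x = 0 ∨ P.eval x ^ c = 1 := by simpa using hx
    have hterm : ∀ f : F[X], (hasseDeriv k (P ^ (l + c) * f)).eval x =
        P.eval x ^ c * (hasseDeriv k (P ^ (l + c) * f)).eval x := by
      intro f
      rcases hx' with hx' | hx'
      · obtain ⟨T, hT⟩ := pow_dvd_hasseDeriv_pow_mul P f (l + c) k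
        rw [hT, eval_mul, eval_pow, hx', zero_pow (by omega)]
        simp
      · rw [hx', one_mul]
    have hterm2 : ∀ f : F[X], (hasseDeriv k (P ^ l * f)).eval x =
        P.eval x ^ c * (P.eval x ^ c * (hasseDeriv k (P ^ l * f)).eval x) := by
      intro f
      rcases hx' with hx' | hx'
      · obtain ⟨T, hT⟩ := pow_dvd_hasseDeriv_pow_mul P f l k
        rw [hT, eval_mul, eval_pow, hx', zero_pow (by omega)]
        simp
      · rw [hx', one_mul, one_mul]
    have hzero := congrArg (eval x) (hv' k hk)
    rw [eval_zero, eval_finsetSum] at hzero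
    rw [hΦ, map_sum, eval_finsetSum, ← mul_zero (P.eval x ^ c), ← hzero, Finset.mul_sum]
    refine Finset.sum_congr rfl fun j _ => ?_
    rw [hasseDeriv_mul_expand_card _ _ (by omega), map_add, eval_mul, eval_add, hterm, hterm2,
      expand_eval, FiniteField.pow_card]
    simp only [eval_mul, eval_add, eval_pow, eval_X]
    ring
  · refine (natDegree_mul_le_of_le natDegree_pow_le (show Ψ.natDegree ≤
      c * P.natDegree + B + q * J from ?_)).trans (by ring_nf; omega)
    refine natDegree_sum_le_of_forall_le _ _ fun j hj => ?_
    have hj : j ≤ J := by simpa [Nat.lt_succ_iff] using hj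
    have e1 : (r j + P ^ c * s j).natDegree ≤ c * P.natDegree + B :=
      natDegree_add_le_of_degree_le ((hr j).trans (by omega))
        (natDegree_mul_le_of_le natDegree_pow_le (hs j))
    refine natDegree_mul_le_of_le e1 ((natDegree_X_pow_le _).trans (Nat.mul_le_mul_left q hj))

theorem exists_stepanov_parameters {q c d : ℕ} (hc : q = 2 * c + 1) (hd : 1 ≤ d)
    (hq : 4 * (d + 2) ^ 2 ≤ q) :
    ∃ l B J : ℕ, 1 ≤ l ∧ l ≤ q ∧ q < (l + 2) ^ 2 ∧ 2 * B + d < q ∧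
      ∑ k ∈ Finset.range l, (B + k * (d - 1) + (J + 1)) < 2 * ((J + 1) * (B + 1)) ∧
      2 * ((l + c) * d + B + q * J) ≤ 2 * l * d + q * l + 2 * q * d := by
  obtain ⟨l, hl1, hlq, hlq', hpar⟩ : ∃ l : ℕ, 1 ≤ l ∧ l ^ 2 ≤ q ∧ q < (l + 2) ^ 2 ∧
      (l + d + 1) % 2 = 0 := by
    have h1 : q.sqrt ^ 2 ≤ q := Nat.sqrt_le' q
    have h2 : q < (q.sqrt + 1) ^ 2 := Nat.lt_succ_sqrt' q
    have h3 : 2 ≤ q.sqrt := Nat.le_sqrt'.2 (by nlinarith)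
    rcases Nat.mod_two_eq_zero_or_one (q.sqrt + d + 1) with h | h
    · exact ⟨q.sqrt, by omega, h1, by nlinarith, h⟩
    · obtain ⟨t, ht⟩ : ∃ t, q.sqrt = t + 1 := ⟨q.sqrt - 1, by omega⟩
      rw [ht] at h1 h2 h3 h
      exact ⟨t, by omega, by nlinarith, by nlinarith, by omega⟩
  obtain ⟨J, hJ⟩ : ∃ J, l + d + 1 = 2 * (J + 1) := ⟨(l + d + 1) / 2 - 1, by omega⟩
  obtain ⟨B, hB1, hB2⟩ : ∃ B, 2 * B + d < q ∧ q ≤ 2 * B + d + 2 :=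
    ⟨(q - d - 1) / 2, by
      have : d + 1 ≤ q := by nlinarith
      omega⟩
  refine ⟨l, B, J, hl1, by nlinarith, hlq', hB1, ?_, ?_⟩
  · have hsum : 2 * ∑ k ∈ Finset.range l, (B + k * (d - 1) + (J + 1)) =
        2 * l * (B + J + 1) + (d - 1) * (l * (l - 1)) := by
      rw [← Finset.sum_range_id_mul_two l]
      simp only [Finset.sum_add_distrib, Finset.sum_const, Finset.card_range, smul_eq_mul,
        ← Finset.sum_mul]
      ring
    suffices h : 2 * l * (B + J + 1) + (d - 1) * (l * (l - 1)) < 4 * ((J + 1) * (B + 1)) by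
      omega
    obtain ⟨e, rfl⟩ : ∃ e, d = e + 1 := ⟨d - 1, by omega⟩
    obtain ⟨m, rfl⟩ : ∃ m, l = m + 1 := ⟨l - 1, by omega⟩
    simp only [Nat.add_sub_cancel]
    have hJ' : 4 * ((J + 1) * (B + 1)) = (m + 1 + (e + 1) + 1) * (2 * B + 2) := by
      rw [hJ]; ring
    have hJ'' : 2 * (m + 1) * (B + J + 1) = (m + 1) * (2 * B + (m + 1 + (e + 1) + 1)) := by
      rw [hJ]; ring
    rw [hJ', hJ'']
    have h5 : (e + 2) * q ≤ (e + 2) * (2 * B + (e + 1) + 2) := Nat.mul_le_mul_left _ hB2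
    nlinarith
  · have e1 : 2 * (q * J) + q = q * l + q * d := by
      have : 2 * J + 1 = l + d := by omega
      calc 2 * (q * J) + q = q * (2 * J + 1) := by ring
        _ = _ := by rw [this]; ring
    have e2 : 2 * (c * d) + d = q * d := by rw [hc]; ring
    nlinarith

open Classical in
theorem sum_quadraticChar_eval_le_of_eval_zero_ne {K : Type*} [Field K] (φ : F →+* K) {P : F[X]}
    (hodd : Odd (Fintype.card F)) (β : K) (h0 : P.eval₂ φ β = 0)
    (h1 : (derivative P).eval₂ φ β ≠ 0) (hP0 : P.eval 0 ≠ 0)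
    (hq : 4 * (P.natDegree + 2) ^ 2 ≤ Fintype.card F) :
    ((∑ x : F, quadraticChar F (P.eval x) : ℤ) : ℝ) ≤
      2 * P.natDegree * √(Fintype.card F) + 8 * P.natDegree := by
  have hd : 1 ≤ P.natDegree := by
    by_contra hcon
    rw [eq_C_of_natDegree_eq_zero (show P.natDegree = 0 by omega)] at h1
    simp at h1
  obtain ⟨c, hc⟩ := hodd
  obtain ⟨l, B, J, hl1, hlq, hlq', hB, hsum, hbd⟩ := exists_stepanov_parameters hc hd hq
  have hN := card_mul_le_of_stepanov φ hc β h0 h1 hP0 l B J hlq hB hsum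
  set N := (Finset.univ.filter fun x : F => P.eval x = 0 ∨ P.eval x ^ c = 1).card with hNdef
  set d := P.natDegree
  set q := Fintype.card F with hqdef
  have hchar : ringChar F ≠ 2 := by
    intro h
    have := FiniteField.even_card_of_char_two h
    omega
  have hS : (∑ x : F, quadraticChar F (P.eval x) : ℤ) ≤ 2 * N - q := by
    have e : (2 * N - q : ℤ) =
        ∑ x : F, (2 * (if P.eval x = 0 ∨ P.eval x ^ c = 1 then 1 else 0) - 1 : ℤ) := by
      rw [Finset.sum_sub_distrib, ← Finset.mul_sum, ← Finset.sum_filter]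
      simp [hqdef, hNdef]
    rw [e]
    refine Finset.sum_le_sum fun x _ => ?_
    rcases eq_or_ne (P.eval x) 0 with hx | hx
    · simp [hx]
    · rcases quadraticChar_dichotomy hx with h | h
      · have := quadraticChar_eq_pow_of_char_ne_two' hchar (P.eval x)
        rw [h, ← hqdef, show q / 2 = c by omega] at this
        rw [h, if_pos (Or.inr (by simpa using this.symm))]
        norm_num
      · rw [h]
        split_ifs <;> norm_num
  have hl : (1 : ℝ) ≤ l := by exact_mod_cast hl1
  have h2 : (2 * (N * l) : ℝ) ≤ 2 * l * d + q * l + 2 * q * d := by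
    exact_mod_cast (Nat.mul_le_mul_left 2 hN).trans hbd
  have hSR : ((∑ x : F, quadraticChar F (P.eval x) : ℤ) : ℝ) ≤ 2 * N - q := by
    exact_mod_cast hS
  set Q := √(q : ℝ)
  have hQ : Q ^ 2 = q := Real.sq_sqrt (by positivity)
  have hQ0 : 0 ≤ Q := Real.sqrt_nonneg _
  have hQl : Q < l + 2 := by
    refine lt_of_pow_lt_pow_left₀ 2 (by positivity) ?_
    rw [hQ]
    exact_mod_cast hlq'
  have hQ6 : 6 ≤ Q := by
    refine (sq_le_sq₀ (by norm_num) hQ0).1 ?_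
    rw [hQ]
    have : 36 ≤ q := by nlinarith
    have : (36 : ℝ) ≤ q := by exact_mod_cast this
    linarith
  have hdR : (0 : ℝ) ≤ d := by positivity
  have hql : (q : ℝ) ≤ l * (Q + 3) := by
    rw [← hQ]; nlinarith
  refine hSR.trans ?_
  have h3 : (2 * N - q : ℝ) * l ≤ (2 * d * Q + 8 * d) * l := by nlinarith
  exact le_of_mul_le_mul_right h3 (by linarith)

open Classical in
theorem sum_quadraticChar_eval_le {K : Type*} [Field K] (φ : F →+* K) {P : F[X]}
    (hodd : Odd (Fintype.card F)) (β : K) (h0 : P.eval₂ φ β = 0)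
    (h1 : (derivative P).eval₂ φ β ≠ 0)
    (hq : 4 * (P.natDegree + 2) ^ 2 ≤ Fintype.card F) :
    ((∑ x : F, quadraticChar F (P.eval x) : ℤ) : ℝ) ≤
      2 * P.natDegree * √(Fintype.card F) + 8 * P.natDegree := by
  obtain ⟨y, hy⟩ : ∃ y, P.eval y ≠ 0 := by
    by_contra! hcon
    have : P = 0 := eq_zero_of_natDegree_lt_card_of_eval_eq_zero P Function.injective_id hcon
      (by nlinarith)
    rw [this] at h1
    simp at h1
  have hev : ∀ f : F[X], (taylor y f).eval₂ φ (β - φ y) = f.eval₂ φ β := by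
    intro f
    rw [taylor_apply, eval₂_comp]
    simp
  have := sum_quadraticChar_eval_le_of_eval_zero_ne φ (P := taylor y P) hodd (β - φ y)
    (by rw [hev, h0]) (by
      rw [show derivative (taylor y P) = taylor y (derivative P) by
        simp [taylor_apply, derivative_comp], hev]
      exact h1)
    (by rw [taylor_eval, zero_add]; exact hy) (by rwa [natDegree_taylor])
  rw [natDegree_taylor] at this
  refine le_of_eq_of_le ?_ this
  rw [← Equiv.sum_comp (Equiv.addRight y)]
  simp [taylor_eval]

open Classical in
/-- A weak form of Weil's bound for quadratic character sums. -/
theorem abs_sum_quadraticChar_eval_le {K : Type*} [Field K] (φ : F →+* K) {P : F[X]}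
    (hodd : Odd (Fintype.card F)) (β : K) (h0 : P.eval₂ φ β = 0)
    (h1 : (derivative P).eval₂ φ β ≠ 0)
    (hq : 4 * (P.natDegree + 2) ^ 2 ≤ Fintype.card F) :
    |((∑ x : F, quadraticChar F (P.eval x) : ℤ) : ℝ)| ≤
      2 * P.natDegree * √(Fintype.card F) + 8 * P.natDegree := by
  refine abs_le'.2 ⟨sum_quadraticChar_eval_le φ hodd β h0 h1 hq, ?_⟩
  have hchar : ringChar F ≠ 2 := by
    intro h
    have := FiniteField.even_card_of_char_two h
    obtain ⟨c, hc⟩ := hodd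
    omega
  obtain ⟨ν, hν⟩ := FiniteField.exists_nonsquare hchar
  have hν0 : ν ≠ 0 := by rintro rfl; exact hν (IsSquare.zero)
  have hχ : quadraticChar F ν = -1 := quadraticChar_neg_one_iff_not_isSquare.2 hν
  have hdeg : (C ν * P).natDegree = P.natDegree := natDegree_C_mul hν0
  have := sum_quadraticChar_eval_le φ (P := C ν * P) hodd β (by rw [eval₂_mul, h0, mul_zero])
    (by
      rw [derivative_C_mul, eval₂_mul, eval₂_C]
      exact mul_ne_zero (by simpa using hν0) h1) (by rwa [hdeg])
  rw [hdeg] at this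
  refine le_of_eq_of_le ?_ this
  simp only [eval_mul, eval_C, map_mul, hχ, neg_mul, one_mul, Finset.sum_neg_distrib, Int.cast_neg]

end Stepanov

section Resultant

variable {F : Type*} [Field F]

theorem Monic.resultant_eq_of_le {f : F[X]} (hf : f.Monic) (h : F[X]) {k : ℕ}
    (hk : h.natDegree ≤ k) : resultant f h f.natDegree k = resultant f h := by
  obtain ⟨j, rfl⟩ := Nat.exists_eq_add_of_le hk
  rw [resultant_add_right_deg _ _ _ _ _ le_rfl, hf.coeff_natDegree, one_pow, one_mul]

theorem Monic.resultant_mul_right_eq {f : F[X]} (hf : f.Monic) (g h : F[X]) :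
    resultant f (g * h) = resultant f g * resultant f h := by
  rw [← hf.resultant_eq_of_le (g * h) natDegree_mul_le, resultant_mul_right _ _ _ _ le_rfl]

theorem Monic.resultant_add_mul_eq {f : F[X]} (hf : f.Monic) (g p : F[X]) :
    resultant f (g + f * p) = resultant f g := by
  set k := max (p.natDegree + f.natDegree) g.natDegree
  rw [← hf.resultant_eq_of_le (k := k) (g + f * p), ← hf.resultant_eq_of_le (k := k) g (by omega),
    resultant_add_mul_right _ _ _ _ _ (by omega) le_rfl]
  refine (natDegree_add_le _ _).trans (max_le (by omega) (natDegree_mul_le.trans (by omega)))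

theorem Monic.resultant_derivative_mul {f g : F[X]} (hf : f.Monic) (hg : g.Monic) :
    resultant (f * g) (derivative (f * g)) =
      (-1) ^ (f.natDegree * g.natDegree) * resultant f g ^ 2 *
        (resultant f (derivative f) * resultant g (derivative g)) := by
  rw [← (hf.mul hg).resultant_eq_of_le (derivative (f * g)) le_rfl, hf.natDegree_mul hg,
    resultant_mul_left _ _ _ _ le_rfl, hf.resultant_eq_of_le _ le_rfl,
    hg.resultant_eq_of_le _ le_rfl, derivative_mul, hf.resultant_add_mul_eq,
    hf.resultant_mul_right_eq, add_comm, mul_comm (derivative f) g, hg.resultant_add_mul_eq,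
    hg.resultant_mul_right_eq, resultant_comm g f]
  rw [mul_comm g.natDegree]
  ring

theorem Monic.resultant_derivative_of_sq_dvd {f p : F[X]} (hf : f.Monic) (hp : ¬ IsUnit p)
    (h : p * p ∣ f) : resultant f (derivative f) = 0 := by
  rw [resultant_eq_zero_iff]
  refine ⟨Or.inl hf.ne_zero, fun hc => hp (hc.isUnit_of_dvd' ((dvd_mul_right p p).trans h) ?_)⟩
  obtain ⟨g, rfl⟩ := h
  simp only [derivative_mul]
  exact ⟨derivative p * g + derivative p * g + p * derivative g, by ring⟩

end Resultant

section Stickelberger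

variable {F : Type*} [Field F] [Fintype F]

theorem choose_two_add (n m : ℕ) : (n + m).choose 2 = n.choose 2 + m.choose 2 + n * m := by
  induction m with
  | zero => simp
  | succ m ih =>
    rw [← add_assoc, Nat.choose_succ_succ' (n + m) 1, Nat.choose_succ_succ' m 1, ih]
    simp
    ring

open Classical in
/-- The value of the Möbius function predicted by Pellet's formula. -/
noncomputable def pelletSign (f : F[X]) : ℤ :=
  (-1) ^ f.natDegree *
    quadraticChar F ((-1) ^ f.natDegree.choose 2 * resultant f (derivative f))

theorem Monic.pelletSign_mul {f g : F[X]} (hf : f.Monic) (hg : g.Monic) (hc : IsCoprime f g) :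
    pelletSign (f * g) = pelletSign f * pelletSign g := by
  have h0 : resultant f g ≠ 0 := fun h => (resultant_eq_zero_iff.1 h).2 hc
  classical
  have key : (-1 : F) ^ (f * g).natDegree.choose 2 * resultant (f * g) (derivative (f * g)) =
      resultant f g ^ 2 * (((-1) ^ f.natDegree.choose 2 * resultant f (derivative f)) *
        ((-1) ^ g.natDegree.choose 2 * resultant g (derivative g))) := by
    rw [hf.resultant_derivative_mul hg, hf.natDegree_mul hg, choose_two_add, pow_add, pow_add]
    have : ((-1 : F) ^ (f.natDegree * g.natDegree)) *
        (-1 : F) ^ (f.natDegree * g.natDegree) = 1 := by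
      rw [← mul_pow]; simp
    linear_combination ((-1 : F) ^ f.natDegree.choose 2 * (-1) ^ g.natDegree.choose 2 *
      resultant f g ^ 2 * resultant f (derivative f) * resultant g (derivative g)) * this
  unfold pelletSign
  rw [key, map_mul, quadraticChar_sq_one' h0, map_mul, hf.natDegree_mul hg, pow_add]
  ring

theorem pelletSign_one : pelletSign (1 : F[X]) = 1 := by
  simp [pelletSign]

end Stickelberger

theorem resultant_nodal_derivative {L : Type*} [CommRing L] [IsDomain L] {n : ℕ} (v : Fin n → L) :
    resultant (Lagrange.nodal Finset.univ v) (derivative (Lagrange.nodal Finset.univ v)) =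
      (-1) ^ n.choose 2 * (Matrix.vandermonde v).det ^ 2 := by
  have h1 : ∀ i, eval (v i) (derivative (Lagrange.nodal Finset.univ v)) =
      ∏ j ∈ ({i}ᶜ : Finset (Fin n)), (v i - v j) := fun i => by
    rw [Lagrange.eval_nodal_derivative_eval_node_eq (Finset.mem_univ i), Lagrange.eval_nodal]
    refine Finset.prod_congr ?_ fun _ _ => rfl
    ext j; simp
  have h2 : ∀ g : L[X],
      resultant (Lagrange.nodal Finset.univ v) g = ∏ i, g.eval (v i) := fun g => by
    rw [Lagrange.nodal, resultant_prod_left _ _ _ _ (by simp) le_rfl]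
    exact Finset.prod_congr rfl fun i _ => by
      rw [natDegree_X_sub_C, resultant_X_sub_C_left (hg := le_rfl)]
  rw [h2, Finset.prod_congr rfl fun i _ => h1 i, Matrix.det_vandermonde,
    ← Finset.prod_prod_Ioi_mul_eq_prod_prod_off_diag fun j i => v i - v j]
  have h3 : ∀ i : Fin n, ∏ j ∈ Finset.Ioi i, ((v i - v j) * (v j - v i)) =
      (-1) ^ (n - 1 - i) * (∏ j ∈ Finset.Ioi i, (v j - v i)) ^ 2 := fun i => by
    rw [← Fin.card_Ioi, ← Finset.prod_const, ← Finset.prod_pow, ← Finset.prod_mul_distrib]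
    exact Finset.prod_congr rfl fun j _ => by ring
  rw [Finset.prod_congr rfl fun i _ => h3 i, Finset.prod_mul_distrib, Finset.prod_pow,
    Finset.prod_pow_eq_pow_sum, Fin.sum_univ_eq_sum_range fun i => n - 1 - i]
  rw [Finset.sum_range_reflect (fun i => i) n, Finset.sum_range_id, Nat.choose_two_right]

section Irreducible

universe u
variable {F : Type u} [Field F] [Fintype F]

open AdjoinRoot in
theorem Irreducible.exists_map_eq_nodal {f : F[X]} (hf : Irreducible f) (hm : f.Monic)
    {n : ℕ} (hn : f.natDegree = n) :
    ∃ (L : Type u) (_ : Field L) (_ : Algebra F L) (v : Fin n → L), Function.Injective v ∧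
      f.map (algebraMap F L) = Lagrange.nodal Finset.univ v ∧
      ∀ i, v i ^ Fintype.card F = v (finRotate _ i) := by
  subst hn
  have : Fact (Irreducible f) := ⟨hf⟩
  have hfin : Module.Finite F (AdjoinRoot f) := (powerBasis hf.ne_zero).finite
  have hL : Finite (AdjoinRoot f) := Module.finite_of_finite F
  have hrank : Module.finrank F (AdjoinRoot f) = f.natDegree := by
    rw [(powerBasis hf.ne_zero).finrank, powerBasis_dim]
  set φ := FiniteField.frobeniusAlgHom F (AdjoinRoot f)
  have hbij := FiniteField.bijective_frobeniusAlgHom_pow F (AdjoinRoot f)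
  have hinj : ∀ i j : ℕ, i < f.natDegree → j < f.natDegree →
      (φ ^ i) (root f) = (φ ^ j) (root f) → i = j := fun i j hi hj h => by
    have := @hbij.1 ⟨i, hrank ▸ hi⟩ ⟨j, hrank ▸ hj⟩ (AdjoinRoot.algHom_ext h)
    simpa using this
  have hroot : ∀ i : ℕ,
      (f.map (algebraMap F (AdjoinRoot f))).IsRoot ((φ ^ i) (root f)) := fun i => by
    rw [IsRoot.def, eval_map, ← aeval_def, aeval_algHom_apply]
    simp
  have hv : Function.Injective fun i : Fin f.natDegree => (φ ^ (i : ℕ)) (root f) := fun i j h =>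
    Fin.ext (hinj i j i.2 j.2 h)
  refine ⟨AdjoinRoot f, inferInstance, inferInstance, fun i => (φ ^ (i : ℕ)) (root f), hv, ?_, ?_⟩
  · refine eq_of_monic_of_dvd_of_natDegree_le Lagrange.nodal_monic (hm.map _) ?_ ?_
    · refine Finset.prod_dvd_of_coprime ?_ fun i _ => dvd_iff_isRoot.2 (hroot i)
      exact fun i _ j _ hij => pairwise_coprime_X_sub_C hv hij
    · rw [Lagrange.natDegree_nodal]
      simp
  · intro i
    have hs : ((φ ^ (i : ℕ)) (root f)) ^ Fintype.card F = (φ ^ ((i : ℕ) + 1)) (root f) := by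
      rw [pow_succ', AlgHom.mul_apply, FiniteField.frobeniusAlgHom_apply]
    rw [hs]
    have hn : 0 < f.natDegree := hf.natDegree_pos
    have : NeZero f.natDegree := ⟨hn.ne'⟩
    rw [finRotate_apply]
    beta_reduce
    rw [Fin.val_add]
    by_cases h : (i : ℕ) + 1 < f.natDegree
    · rcases Nat.lt_or_ge 1 f.natDegree with h1 | h1
      · rw [Fin.val_one', Nat.add_mod_mod, Nat.mod_eq_of_lt h]
      · omega
    · have hi : (i : ℕ) + 1 = f.natDegree := by omega
      rw [Fin.val_one', Nat.add_mod_mod, hi, Nat.mod_self]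
      have : φ ^ f.natDegree = 1 := by
        rw [← hrank]
        refine AdjoinRoot.algHom_ext ?_
        have := Fintype.ofFinite (AdjoinRoot f)
        have hpow : ∀ k : ℕ, (φ ^ k) (root f) = root f ^ Fintype.card F ^ k := fun k => by
          induction k with
          | zero => simp
          | succ k ih =>
            rw [pow_succ', AlgHom.mul_apply, ih, map_pow, FiniteField.frobeniusAlgHom_apply,
              ← pow_mul, ← pow_succ']
        refine (hpow _).trans ?_
        rw [← Module.card_eq_pow_finrank, FiniteField.pow_card]
        rfl
      rw [this, pow_zero]

theorem Irreducible.pelletSign_eq {f : F[X]} (hq : Odd (Fintype.card F)) (hf : Irreducible f)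
    (hm : f.Monic) : pelletSign f = -1 := by
  obtain ⟨n, hfn⟩ : ∃ n, f.natDegree = n := ⟨_, rfl⟩
  obtain ⟨L, _, _, v, hv, hfv, hfr⟩ := Irreducible.exists_map_eq_nodal hf hm hfn
  have hn : 0 < n := hfn ▸ hf.natDegree_pos
  set δ := (Matrix.vandermonde v).det
  set Δ := (-1) ^ n.choose 2 * resultant f (derivative f)
  have hδ0 : δ ≠ 0 := Matrix.det_vandermonde_ne_zero_iff.2 hv
  have hδ : algebraMap F L Δ = δ ^ 2 := by
    have h1 : algebraMap F L (resultant f (derivative f)) = (-1) ^ n.choose 2 * δ ^ 2 := by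
      rw [← resultant_nodal_derivative, ← hfv, ← resultant_map_map, derivative_map]
      rw [natDegree_map, natDegree_map]
    rw [map_mul, h1, ← mul_assoc, map_pow, map_neg, map_one, ← mul_pow]
    simp
  have hδq : δ ^ Fintype.card F = (-1) ^ (n - 1) * δ := by
    have h1 := RingHom.map_det (FiniteField.frobeniusAlgHom F L).toRingHom (Matrix.vandermonde v)
    have h2 : (FiniteField.frobeniusAlgHom F L).toRingHom.mapMatrix (Matrix.vandermonde v) =
        (Matrix.vandermonde v).submatrix (finRotate n) id := by
      ext i j
      simp only [AlgHom.toRingHom_eq_coe, RingHom.mapMatrix_apply, Matrix.map_apply,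
        Matrix.vandermonde_apply, Matrix.submatrix_apply, id, ← hfr, RingHom.coe_coe,
        FiniteField.frobeniusAlgHom_apply]
      rw [pow_right_comm]
    rw [h2, Matrix.det_permute, sign_finRotate] at h1
    simpa using h1
  obtain ⟨m, hm⟩ := hq
  have hδ' : δ ^ (2 * m) = (-1) ^ (n - 1) := mul_right_cancel₀ hδ0 (by rw [← hδq, hm, pow_succ])
  classical
  have hchar : ringChar F ≠ 2 := fun h => by
    have := FiniteField.even_card_of_char_two h
    omega
  have hχ : ((quadraticChar F Δ : ℤ) : F) = (-1) ^ (n - 1) := by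
    apply (algebraMap F L).injective
    rw [quadraticChar_eq_pow_of_char_ne_two' hchar, map_pow, hδ, ← pow_mul, hm,
      show (2 * m + 1) / 2 = m by omega, hδ']
    simp
  have hχ' : quadraticChar F Δ = (-1) ^ (n - 1) := by
    refine Int.cast_injOn_of_ringChar_ne_two hchar ?_ ?_ (by rw [hχ]; simp)
    · rcases quadraticChar_isQuadratic F Δ with h | h | h <;> simp [h]
    · rcases neg_one_pow_eq_or ℤ (n - 1) with h | h <;> simp [h]
  have : pelletSign f = (-1) ^ n * quadraticChar F Δ := by
    unfold pelletSign
    simp only [Δ, ← hfn]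
  rw [this, hχ', ← pow_add, show n + (n - 1) = 2 * (n - 1) + 1 by omega]
  simp [pow_succ, pow_mul]

end Irreducible

theorem Monic.mu_eq_pelletSign {F : Type} [Field F] [Fintype F] (hq : Odd (Fintype.card F))
    {f : F[X]} (hm : f.Monic) : mu f = pelletSign f := by
  classical
  by_cases hsq : Squarefree f
  · obtain ⟨d, hd⟩ : ∃ d, f.natDegree = d := ⟨_, rfl⟩
    induction d using Nat.strong_induction_on generalizing f with
    | _ d ih =>
    by_cases hu : f = 1
    · subst hu
      simp [mu, pelletSign_one]
    obtain ⟨p, hpm, hp, g, rfl⟩ := exists_monic_irreducible_factor f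
      (fun h => hu (hm.eq_one_of_isUnit h))
    have hgm : g.Monic := hpm.of_mul_monic_left hm
    have hgs : Squarefree g := hsq.of_mul_right
    have hc : IsCoprime p g := (hp.coprime_iff_not_dvd).2 fun ⟨k, hk⟩ =>
      hp.not_isUnit (hsq p ⟨k, by rw [hk, mul_assoc]⟩)
    have hdp : 0 < p.natDegree := hp.natDegree_pos
    rw [hpm.natDegree_mul hgm] at hd
    have h1 := ih g.natDegree (by omega) hgm hgs rfl
    rw [hpm.pelletSign_mul hgm hc, Irreducible.pelletSign_eq hq hp hpm]
    push_cast
    rw [← h1]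
    simp only [mu, if_pos hsq, if_pos hgs]
    rw [UniqueFactorizationMonoid.normalizedFactors_mul hpm.ne_zero hgm.ne_zero,
      UniqueFactorizationMonoid.normalizedFactors_irreducible hp]
    simp [pow_add]
  · have h0 : resultant f (derivative f) = 0 := by
      simp only [Squarefree, not_forall] at hsq
      obtain ⟨p, hp, hu⟩ := hsq
      exact hm.resultant_derivative_of_sq_dvd hu hp
    simp [mu, hsq, pelletSign, h0]

section CriticalValues

variable {F : Type*} [Field F]

/-- The polynomial in `t` whose value at `t` is the resultant of `f'` and `f + t`. -/
noncomputable def criticalPoly (f : F[X]) : F[X] :=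
  resultant ((derivative f).map C) (f.map C + C X) (derivative f).natDegree f.natDegree

theorem eval₂_criticalPoly {K : Type*} [Field K] (φ : F →+* K) (f : F[X]) (t : K) :
    (criticalPoly f).eval₂ φ t =
      resultant ((derivative f).map φ) (f.map φ + C t) (derivative f).natDegree f.natDegree := by
  rw [criticalPoly, ← coe_eval₂RingHom, ← resultant_map_map]
  have h : ∀ g : F[X], (g.map C).map (eval₂RingHom φ t) = g.map φ := fun g => by
    rw [Polynomial.map_map]
    congr 1
    ext; simp
  rw [Polynomial.map_add, h, h, map_C, coe_eval₂RingHom, eval₂_X]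

theorem map_criticalPoly {K : Type*} [Field K] [IsAlgClosed K] (φ : F →+* K) (f : F[X]) :
    (criticalPoly f).map φ = C (φ (derivative f).leadingCoeff ^ f.natDegree) *
      (((derivative f).map φ).roots.map fun σ => X + C ((f.map φ).eval σ)).prod := by
  have : Infinite K := IsAlgClosed.instInfinite
  refine Polynomial.funext fun t => ?_
  rw [eval_map, eval₂_criticalPoly]
  have h := resultant_eq_prod_eval ((derivative f).map φ) (f.map φ + C t) f.natDegree
    ((natDegree_add_C).trans_le (natDegree_map_le)) (IsAlgClosed.splits _)
  rw [natDegree_map, leadingCoeff_map] at h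
  rw [h, eval_mul, eval_C, eval_multiset_prod, Multiset.map_map]
  congr 3
  ext σ
  simp [add_comm]

theorem natDegree_criticalPoly_le (f : F[X]) :
    (criticalPoly f).natDegree ≤ (derivative f).natDegree := by
  let φ := algebraMap F (AlgebraicClosure F)
  rw [← natDegree_map φ, map_criticalPoly, ← natDegree_map (p := derivative f) φ]
  refine (natDegree_C_mul_le _ _).trans ((natDegree_multiset_prod_le _).trans ?_)
  rw [Multiset.map_map]
  simp only [Function.comp_def, natDegree_X_add_C, Multiset.map_const', Multiset.sum_replicate,
    smul_eq_mul, mul_one]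
  exact card_roots' _

theorem eval₂_criticalPoly_ne_zero {K : Type*} [Field K] [IsAlgClosed K] (φ : F →+* K) {f : F[X]}
    (h0 : derivative f ≠ 0) {β : K}
    (h : ∀ σ, (derivative f).eval₂ φ σ = 0 → f.eval₂ φ σ ≠ -β) :
    (criticalPoly f).eval₂ φ β ≠ 0 := by
  rw [← eval_map, map_criticalPoly, eval_mul, eval_C, eval_multiset_prod, Multiset.map_map]
  refine mul_ne_zero (pow_ne_zero _ (by simpa using h0)) (Multiset.prod_ne_zero ?_)
  rw [Multiset.mem_map]
  rintro ⟨σ, hσ, h1⟩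
  rw [mem_roots', IsRoot.def, eval_map] at hσ
  refine h σ hσ.2 ?_
  simp only [Function.comp_apply, eval_add, eval_X, eval_C, eval_map] at h1
  linear_combination h1

theorem eval₂_criticalPoly_simple {K : Type*} [Field K] [IsAlgClosed K] (φ : F →+* K) {f : F[X]}
    (h0 : derivative f ≠ 0) {ρ : K} {g : K[X]} (hg : (X - C ρ) * g = (derivative f).map φ)
    (h : ∀ σ, g.eval σ = 0 → f.eval₂ φ σ ≠ f.eval₂ φ ρ) :
    (criticalPoly f).eval₂ φ (-f.eval₂ φ ρ) = 0 ∧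
      (derivative (criticalPoly f)).eval₂ φ (-f.eval₂ φ ρ) ≠ 0 := by
  have hg0 : (X - C ρ) * g ≠ 0 := by rw [hg]; exact (Polynomial.map_ne_zero_iff φ.injective).2 h0
  have hQ := map_criticalPoly φ f
  rw [← hg, roots_mul hg0, roots_X_sub_C, Multiset.map_add, Multiset.prod_add,
    Multiset.map_singleton, Multiset.prod_singleton, eval_map] at hQ
  rw [← eval_map φ (-eval₂ φ ρ f), ← eval_map φ (-eval₂ φ ρ f), ← derivative_map, hQ]
  refine ⟨by simp, ?_⟩
  simp only [derivative_mul, derivative_C, derivative_add, derivative_X, eval_mul, eval_add,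
    eval_X, eval_C, neg_add_cancel, zero_mul, add_zero, zero_add, one_mul]
  refine mul_ne_zero (pow_ne_zero _ (by simpa using h0)) ?_
  rw [eval_multiset_prod, Multiset.map_map]
  refine Multiset.prod_ne_zero ?_
  rw [Multiset.mem_map]
  rintro ⟨σ, hσ, h1⟩
  rw [mem_roots'] at hσ
  refine h σ hσ.2 ?_
  simp only [Function.comp_apply, eval_add, eval_X, eval_C, eval_map] at h1
  linear_combination h1

end CriticalValues

open Classical in
theorem exists_mu_add_C_eq {F : Type} [Field F] [Fintype F] (hq : Odd (Fintype.card F))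
    {f : F[X]} (hm : f.Monic) (hd : 0 < f.natDegree) : ∃ c : ℤ, |c| = 1 ∧
      ∀ t : F, mu (f + C t) = (c * quadraticChar F ((criticalPoly f).eval t) : ℤ) := by
  set n := f.natDegree with hn
  set m := (derivative f).natDegree with hm'
  refine ⟨(-1) ^ n * quadraticChar F ((-1) ^ n.choose 2 * (-1) ^ (n * m)), ?_, fun t => ?_⟩
  · rw [abs_mul, abs_pow, abs_neg, abs_one, one_pow, one_mul]
    rcases quadraticChar_dichotomy (F := F) (a := (-1) ^ n.choose 2 * (-1) ^ (n * m)) (by simp)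
      with h | h <;> simp [h]
  · have hmt : (f + C t).Monic :=
      hm.add_of_left (degree_C_le.trans_lt (natDegree_pos_iff_degree_pos.1 hd))
    rw [hmt.mu_eq_pelletSign hq]
    congr 1
    have hQ : (criticalPoly f).eval t = resultant (derivative f) (f + C t) m n := by
      have := eval₂_criticalPoly (RingHom.id F) f t
      rw [eval₂_id, Polynomial.map_id, Polynomial.map_id] at this
      exact this
    rw [pelletSign, natDegree_add_C, derivative_add, derivative_C, add_zero, mul_assoc, ← map_mul,
      ← natDegree_add_C (p := f) (a := t), resultant_comm, hQ]
    rw [natDegree_add_C]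
    simp only [← hn, ← hm', mul_assoc]

theorem natDegree_det_le_mul {R : Type*} [CommRing R] {n d : ℕ} (M : Matrix (Fin n) (Fin n) R[X])
    (h : ∀ i j, (M i j).natDegree ≤ d) : M.det.natDegree ≤ n * d := by
  rw [Matrix.det_apply]
  refine natDegree_sum_le_of_forall_le _ _ fun σ _ => ?_
  refine (natDegree_smul_le _ _).trans ((natDegree_prod_le _ _).trans ?_)
  refine (Finset.sum_le_sum fun i _ => h (σ i) i).trans ?_
  simp

theorem natDegree_resultant_le {R : Type*} [CommRing R] {A B : R[X][X]} {m n d : ℕ}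
    (hA : ∀ i, (A.coeff i).natDegree ≤ d) (hB : ∀ i, (B.coeff i).natDegree ≤ d) :
    (resultant A B m n).natDegree ≤ (m + n) * d := by
  refine natDegree_det_le_mul _ fun i j => ?_
  simp only [sylvester, Matrix.of_apply]
  refine Fin.addCases (fun k => ?_) (fun k => ?_) j
  · rw [Fin.addCases_left]
    split_ifs
    · exact hB _
    · simp
  · rw [Fin.addCases_right]
    split_ifs
    · exact hA _
    · simp

theorem exists_prime_dvd_of_resultant_eq_zero {R : Type*} [CommRing R] [IsDomain R]
    [UniqueFactorizationMonoid R] {A B : R[X]} (hA : IsUnit A.leadingCoeff) {n : ℕ}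
    (hB : B.natDegree ≤ n) (h : resultant A B A.natDegree n = 0) :
    ∃ E, Prime E ∧ E ∣ A ∧ E ∣ B := by
  let L := FractionRing R
  let φ := algebraMap R L
  have hφ : Function.Injective φ := IsFractionRing.injective R L
  have hA0 : A ≠ 0 := fun h0 => by simp [h0] at hA
  have hres : resultant (A.map φ) (B.map φ) = 0 := by
    have h1 : resultant (A.map φ) (B.map φ) A.natDegree n = 0 := by
      rw [resultant_map_map, h, map_zero]
    obtain ⟨j, rfl⟩ := Nat.exists_eq_add_of_le hB
    have h2 := resultant_add_right_deg (A.map φ) (B.map φ) A.natDegree B.natDegree j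
      natDegree_map_le
    rw [h1, eq_comm, mul_eq_zero, coeff_map] at h2
    rw [natDegree_map_eq_of_injective hφ, natDegree_map_eq_of_injective hφ]
    refine h2.resolve_left (pow_ne_zero _ ?_)
    rw [map_ne_zero_iff _ hφ]
    exact leadingCoeff_ne_zero.2 hA0
  rw [resultant_eq_zero_iff] at hres
  obtain ⟨π, hπ, hπA, hπB⟩ : ∃ π, Irreducible π ∧ π ∣ A.map φ ∧ π ∣ B.map φ := by
    by_contra hcon
    push Not at hcon
    refine hres.2 (isCoprime_of_irreducible_dvd ?_ fun z hz h1 h2 => hcon z hz h1 h2)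
    exact fun h0 => (Polynomial.map_ne_zero_iff hφ).2 hA0 h0.1
  have hunit : ∀ E : R[X], E ∣ A → E.natDegree = 0 → IsUnit E := fun E hE hd => by
    rw [eq_C_of_natDegree_eq_zero hd] at hE ⊢
    rw [C_dvd_iff_dvd_coeff] at hE
    exact isUnit_C.2 (isUnit_of_dvd_unit (hE A.natDegree) hA)
  obtain ⟨E, hE, hEA, hπE⟩ : ∃ E, Prime E ∧ E ∣ A ∧ π ∣ E.map φ := by
    obtain ⟨s, hs, u, hu⟩ := UniqueFactorizationMonoid.exists_prime_factors A hA0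
    rw [← hu, Polynomial.map_mul, hπ.prime.dvd_mul, Polynomial.map_multiset_prod] at hπA
    rcases hπA with h1 | h1
    · obtain ⟨E', hE', h2⟩ := hπ.prime.exists_mem_multiset_dvd h1
      obtain ⟨E, hE, rfl⟩ := Multiset.mem_map.1 hE'
      exact ⟨E, hs E hE, hu ▸ (Multiset.dvd_prod hE).mul_right _, h2⟩
    · exact absurd (isUnit_of_dvd_unit h1 (u.isUnit.map (mapRingHom φ))) hπ.not_isUnit
  have hprim : E.IsPrimitive :=
    hE.irreducible.isPrimitive fun h0 => hE.not_isUnit (hunit E hEA h0)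
  let := Classical.choice (inferInstance : Nonempty (NormalizedGCDMonoid R))
  have hirr := (hprim.irreducible_iff_irreducible_map_fraction_map (K := L)).1 hE.irreducible
  exact ⟨E, hE, hEA, hprim.dvd_of_fraction_map_dvd_fraction_map (K := L)
    ((hπ.dvd_symm hirr hπE).trans hπB)⟩

section Jacobian

variable {K : Type*} [Field K]

/-- The derivative of a bivariate polynomial with respect to the inner variable. -/
noncomputable def innerDerivative (p : K[X][X]) : K[X][X] :=
  Bivariate.swap (derivative (Bivariate.swap p))

theorem innerDerivative_mul (p q : K[X][X]) :
    innerDerivative (p * q) = innerDerivative p * q + p * innerDerivative q := by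
  simp [innerDerivative, derivative_mul, Bivariate.swap_swap_apply]

theorem innerDerivative_sub_C (h g : K[X]) :
    innerDerivative (h.map C - C g) = - C (derivative g) := by
  rw [innerDerivative, map_sub, Bivariate.swap_map_C, Bivariate.swap_C, derivative_sub,
    derivative_C, zero_sub, derivative_map, map_neg, Bivariate.swap_map_C]

theorem dvd_jacobian {E A B : K[X][X]} (hA : E ∣ A) (hB : E ∣ B) :
    E ∣ innerDerivative A * derivative B - derivative A * innerDerivative B := by
  obtain ⟨a, rfl⟩ := hA
  obtain ⟨b, rfl⟩ := hB
  simp only [innerDerivative_mul, derivative_mul]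
  exact ⟨innerDerivative E * a * derivative b + innerDerivative a * derivative E * b +
    E * innerDerivative a * derivative b - derivative E * a * innerDerivative b -
    derivative a * innerDerivative E * b - E * derivative a * innerDerivative b, by ring⟩

theorem natDegree_pos_of_derivative_ne_zero {h : K[X]} (hh : derivative h ≠ 0) :
    0 < h.natDegree := by
  refine Nat.pos_of_ne_zero fun h0 => hh ?_
  rw [eq_C_of_natDegree_eq_zero h0, derivative_C]

theorem natDegree_map_C_sub_C (h g : K[X]) :
    (h.map C - C g).natDegree = h.natDegree := by
  rw [natDegree_sub_C, natDegree_map_eq_of_injective C_injective]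

theorem leadingCoeff_map_C_sub_C {h : K[X]} (hh : derivative h ≠ 0) (g : K[X]) :
    (h.map C - C g).leadingCoeff = C h.leadingCoeff := by
  rw [leadingCoeff, natDegree_map_C_sub_C, coeff_sub, coeff_map,
    coeff_C_of_ne_zero (natDegree_pos_of_derivative_ne_zero hh).ne', sub_zero, leadingCoeff]

theorem isUnit_leadingCoeff_map_C_sub_C {h : K[X]} (hh : derivative h ≠ 0) (g : K[X]) :
    IsUnit (h.map C - C g).leadingCoeff := by
  rw [leadingCoeff_map_C_sub_C hh, isUnit_C, isUnit_iff_ne_zero, leadingCoeff_ne_zero]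
  rintro rfl
  simp at hh

theorem not_dvd_C_of_dvd {E : K[X][X]} (hE : Prime E) {h g p : K[X]} (hh : derivative h ≠ 0)
    (hd : E ∣ h.map C - C g) (hp : p ≠ 0) : ¬ E ∣ C p := by
  intro hEp
  have h0 : E.natDegree = 0 := by
    have := natDegree_le_of_dvd hEp (C_ne_zero.2 hp)
    simpa using this
  rw [eq_C_of_natDegree_eq_zero h0] at hd
  refine hE.not_isUnit ?_
  rw [eq_C_of_natDegree_eq_zero h0, isUnit_C]
  exact isUnit_of_dvd_unit ((C_dvd_iff_dvd_coeff _ _).1 hd _) (isUnit_leadingCoeff_map_C_sub_C hh g)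

theorem X_sub_C_X_dvd_of_dvd {f₁ f₂ : K[X]} (h₁ : derivative (derivative f₁) ≠ 0)
    (h₂ : derivative (derivative f₂) ≠ 0) {E : K[X][X]} (hE : Prime E)
    (hA : E ∣ (derivative f₂).map C - C (derivative f₁))
    (hB : E ∣ (f₂ - X * derivative f₂).map C - C (f₁ - X * derivative f₁)) :
    X - C X ∣ E := by
  have hJ := dvd_jacobian hA hB
  have hk : ∀ f : K[X], derivative (f - X * derivative f) = - (X * derivative (derivative f)) := by
    intro f
    simp
  rw [innerDerivative_sub_C, innerDerivative_sub_C, derivative_sub, derivative_sub, derivative_C,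
    derivative_C, derivative_map, derivative_map, hk, hk] at hJ
  have hJ' : E ∣ C (derivative (derivative f₁)) * (derivative (derivative f₂)).map C *
      (X - C X) := by
    convert hJ using 1
    simp
    ring
  rcases hE.dvd_or_dvd hJ' with h | h
  · rcases hE.dvd_or_dvd h with h | h
    · exact absurd h (not_dvd_C_of_dvd hE h₂ hA h₁)
    · have hsE : Prime (Bivariate.swap E) :=
        (MulEquiv.prime_iff (Bivariate.swap : K[X][X] ≃ₐ[K] K[X][X]).toMulEquiv).2 hE
      have hA'   := _root_.map_dvd (Bivariate.swap : K[X][X] ≃ₐ[K] K[X][X]) hA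
      have h'   := _root_.map_dvd (Bivariate.swap : K[X][X] ≃ₐ[K] K[X][X]) h
      rw [map_sub, Bivariate.swap_map_C, Bivariate.swap_C, ← dvd_neg, neg_sub] at hA'
      rw [Bivariate.swap_map_C] at h'
      exact absurd h' (not_dvd_C_of_dvd hsE h₁ hA' h₂)
  · exact hE.irreducible.dvd_symm (prime_X_sub_C X).irreducible h

end Jacobian

section Avoidance

variable {K : Type*} [Field K]

theorem exists_eval_eq_zero_of_common_root {A B : K[X][X]} {n : ℕ} (hA : IsUnit A.leadingCoeff)
    (hAd : A.natDegree + 1 ≤ n) (hBd : B.natDegree ≤ n) (hAc : ∀ i, (A.coeff i).natDegree ≤ n)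
    (hBc : ∀ i, (B.coeff i).natDegree ≤ n) (hAB : ∀ E, Prime E → E ∣ A → ¬ E ∣ B) :
    ∃ W : K[X], W ≠ 0 ∧ W.natDegree ≤ (2 * n - 1) * n ∧ ∀ ρ σ,
      (A.map (evalRingHom ρ)).eval σ = 0 → (B.map (evalRingHom ρ)).eval σ = 0 → W.eval ρ = 0 := by
  refine ⟨resultant A B A.natDegree n, fun h => ?_,
    (natDegree_resultant_le hAc hBc).trans (Nat.mul_le_mul_right n (by omega)), fun ρ σ h1 h2 => ?_⟩
  · obtain ⟨E, hE, h1, h2⟩ := exists_prime_dvd_of_resultant_eq_zero hA hBd h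
    exact hAB E hE h1 h2
  · obtain ⟨p, q, -, -, h⟩ := exists_mul_add_mul_eq_C_resultant A B (m := A.natDegree) (n := n)
      le_rfl hBd (Or.inr (by omega))
    have h3 := congrArg (fun P => (P.map (evalRingHom ρ)).eval σ) h
    simpa [h1, h2] using h3.symm

theorem natDegree_coeff_map_C_sub_C_le (h : K[X]) {g : K[X]} {n : ℕ} (hg : g.natDegree ≤ n)
    (i : ℕ) :
    ((h.map C - C g).coeff i).natDegree ≤ n := by
  rw [coeff_sub, coeff_map]
  refine (natDegree_sub_le _ _).trans ?_
  rw [natDegree_C, coeff_C]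
  split_ifs <;> simp [hg]

theorem exists_X_sub_C_X_mul_eq (h : K[X]) : ∃ A : K[X][X],
    (X - C X) * A = h.map C - C h ∧ ∀ i, (A.coeff i).natDegree ≤ h.natDegree := by
  refine ⟨∑ i ∈ Finset.range (h.natDegree + 1), C (C (h.coeff i)) *
    ∑ l ∈ Finset.range i, X ^ l * C X ^ (i - 1 - l), ?_, fun i => ?_⟩
  · have h1 : ∀ i, (X - C X : K[X][X]) * (C (C (h.coeff i)) *
        ∑ l ∈ Finset.range i, X ^ l * C X ^ (i - 1 - l)) =
          C (C (h.coeff i)) * X ^ i - C (C (h.coeff i) * X ^ i) := fun i => by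
      rw [mul_left_comm, (Commute.all _ _).mul_geom_sum₂, mul_sub, C_mul, C_pow]
    rw [Finset.mul_sum, Finset.sum_congr rfl fun i _ => h1 i, Finset.sum_sub_distrib]
    conv_rhs => rw [h.as_sum_range_C_mul_X_pow]
    simp [Polynomial.map_sum, map_sum]
  · rw [finsetSum_coeff]
    refine natDegree_sum_le_of_forall_le _ _ fun k hk => ?_
    rw [coeff_C_mul]
    refine (natDegree_C_mul_le _ _).trans ?_
    rw [finsetSum_coeff]
    refine natDegree_sum_le_of_forall_le _ _ fun l _ => ?_
    rw [← C_pow, coeff_mul_C, coeff_X_pow]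
    rw [Finset.mem_range] at hk
    split_ifs
    · rw [one_mul, natDegree_X_pow]
      omega
    · simp

theorem map_evalRingHom_map_C_sub_C (h g : K[X]) (ρ : K) :
    (h.map C - C g).map (evalRingHom ρ) = h - C (g.eval ρ) := by
  rw [Polynomial.map_sub, Polynomial.map_map, map_C, coe_evalRingHom,
    show (evalRingHom ρ).comp C = RingHom.id K by ext; simp, Polynomial.map_id]

theorem natDegree_sub_X_mul_derivative_le {f : K[X]} {n : ℕ} (hf : f.natDegree ≤ n) :
    (f - X * derivative f).natDegree ≤ n := by
  refine (natDegree_sub_le _ _).trans (max_le hf ?_)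
  rcases Nat.eq_zero_or_pos f.natDegree with h | h
  · rw [eq_C_of_natDegree_eq_zero h]; simp
  · refine natDegree_mul_le.trans ?_
    have := natDegree_derivative_lt h.ne'
    rw [natDegree_X]
    omega

theorem exists_eval_eq_zero_of_common_tangent {f₁ f₂ : K[X]} {n : ℕ}
    (h₁ : derivative (derivative f₁) ≠ 0)
    (h₂ : derivative (derivative f₂) ≠ 0) (hd₁ : f₁.natDegree ≤ n) (hd₂ : f₂.natDegree ≤ n)
    (hne : f₁ ≠ f₂) :
    ∃ W : K[X], W ≠ 0 ∧ W.natDegree ≤ (2 * n - 1) * n ∧ ∀ ρ σ,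
      (derivative f₂).eval σ = (derivative f₁).eval ρ →
      (f₂ - X * derivative f₂).eval σ = (f₁ - X * derivative f₁).eval ρ → W.eval ρ = 0 := by
  have hp1 := natDegree_pos_of_derivative_ne_zero (fun h : derivative f₁ = 0 => h₁ (by simp [h]))
  have hp2 := natDegree_pos_of_derivative_ne_zero (fun h : derivative f₂ = 0 => h₂ (by simp [h]))
  have hl1 := natDegree_derivative_lt hp1.ne'
  have hl2 := natDegree_derivative_lt hp2.ne'
  have hAc : ∀ i, (((derivative f₂).map C - C (derivative f₁)).coeff i).natDegree ≤ n := fun i =>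
    natDegree_coeff_map_C_sub_C_le (derivative f₂) (by omega) i
  obtain ⟨k₁, hk₁⟩ : ∃ k, k = f₁ - X * derivative f₁ := ⟨_, rfl⟩
  obtain ⟨k₂, hk₂⟩ : ∃ k, k = f₂ - X * derivative f₂ := ⟨_, rfl⟩
  have hd₁' : k₁.natDegree ≤ n := hk₁ ▸ natDegree_sub_X_mul_derivative_le hd₁
  have hd₂' : k₂.natDegree ≤ n := hk₂ ▸ natDegree_sub_X_mul_derivative_le hd₂
  have hBc : ∀ i, ((k₂.map C - C k₁).coeff i).natDegree ≤ n := fun i =>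
    natDegree_coeff_map_C_sub_C_le _ hd₁' i
  rw [← hk₁, ← hk₂]
  obtain ⟨W, hW0, hWd, hW⟩ := exists_eval_eq_zero_of_common_root (n := n)
    (A := (derivative f₂).map C - C (derivative f₁))
    (B := k₂.map C - C k₁)
    (isUnit_leadingCoeff_map_C_sub_C h₂ _) (by rw [natDegree_map_C_sub_C]; omega)
    (by rw [natDegree_map_C_sub_C]; exact hd₂')
    hAc hBc (by
      intro E hE hEA hEB
      have hX : X - C X ∣ E := X_sub_C_X_dvd_of_dvd h₁ h₂ hE hEA (hk₁ ▸ hk₂ ▸ hEB)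
      have e1 := dvd_iff_isRoot.1 (hX.trans hEA)
      have e2 := dvd_iff_isRoot.1 (hX.trans hEB)
      rw [IsRoot.def, eval_sub, eval_C, eval_map, eval₂_C_X, sub_eq_zero] at e1 e2
      rw [hk₁, hk₂, e1] at e2
      exact hne (sub_left_injective e2).symm)
  refine ⟨W, hW0, hWd, fun ρ σ e1 e2 => hW ρ σ ?_ ?_⟩
  · rw [map_evalRingHom_map_C_sub_C, eval_sub, eval_C, e1, sub_self]
  · rw [map_evalRingHom_map_C_sub_C, eval_sub , eval_C, e2, sub_self]

theorem exists_eval_eq_zero_of_bitangent {f : K[X]} {n : ℕ} (hf : derivative (derivative f) ≠ 0)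
    (hd : f.natDegree ≤ n) :
    ∃ W : K[X], W ≠ 0 ∧ W.natDegree ≤ (2 * n - 1) * n ∧ ∀ ρ σ, ∀ g : K[X],
      (X - C ρ) * g = derivative f - C ((derivative f).eval ρ) → g.eval σ = 0 →
      (f - X * derivative f).eval σ = (f - X * derivative f).eval ρ → W.eval ρ = 0 := by
  have hp := natDegree_pos_of_derivative_ne_zero (fun h : derivative f = 0 => hf (by simp [h]))
  have hl := natDegree_derivative_lt hp.ne'
  obtain ⟨k, hk⟩ : ∃ k, k = f - X * derivative f := ⟨_, rfl⟩
  have hd' : k.natDegree ≤ n := hk ▸ natDegree_sub_X_mul_derivative_le hd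
  have hBc : ∀ i, ((k.map C - C k).coeff i).natDegree ≤ n := fun i =>
    natDegree_coeff_map_C_sub_C_le _ hd' i
  rw [← hk]
  obtain ⟨A, hA, hAc⟩ := exists_X_sub_C_X_mul_eq (derivative f)
  have hlc : A.leadingCoeff = C (derivative f).leadingCoeff := by
    rw [← leadingCoeff_map_C_sub_C hf (derivative f), ← hA, leadingCoeff_mul, leadingCoeff_X_sub_C,
      one_mul]
  have hA0 : A ≠ 0 := by
    rintro rfl
    rw [leadingCoeff_zero, eq_comm, C_eq_zero, leadingCoeff_eq_zero] at hlc
    exact hf (by rw [hlc, derivative_zero])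
  have hAd : A.natDegree + 1 = (derivative f).natDegree := by
    rw [← natDegree_map_C_sub_C (derivative f) (derivative f), ← hA,
      natDegree_mul (X_sub_C_ne_zero X) hA0, natDegree_X_sub_C, add_comm]
  obtain ⟨W, hW0, hWd, hW⟩ := exists_eval_eq_zero_of_common_root (n := n)
    (A := A) (B := k.map C - C k)
    (by rw [hlc, ← leadingCoeff_map_C_sub_C hf (derivative f)]
        exact isUnit_leadingCoeff_map_C_sub_C hf _) (by omega)
    (by rw [natDegree_map_C_sub_C]; exact hd')
    (fun i => (hAc i).trans (by omega))
    hBc (by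
      intro E hE hEA hEB
      have hX := X_sub_C_X_dvd_of_dvd hf hf hE (hA ▸ hEA.mul_left _) (hk ▸ hEB)
      have e1 := dvd_iff_isRoot.1 (hX.trans hEA)
      have e2 := congrArg (fun P => (derivative P).eval X) hA
      rw [IsRoot.def] at e1
      simp [e1, derivative_map, eval_map, eval₂_C_X] at e2
      exact hf e2.symm)
  refine ⟨W, hW0, hWd, fun ρ σ g hg h1 h2 => hW ρ σ ?_ ?_⟩
  · have e := congrArg (Polynomial.map (evalRingHom ρ)) hA
    rw [map_evalRingHom_map_C_sub_C, ← hg, Polynomial.map_mul, Polynomial.map_sub, map_X, map_C,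
      coe_evalRingHom, eval_X] at e
    rw [mul_left_cancel₀ (X_sub_C_ne_zero ρ) e, h1]
  · rw [map_evalRingHom_map_C_sub_C, eval_sub , eval_C, h2, sub_self]

end Avoidance

section Pencil

variable {F K : Type*} [Field F] [Fintype F] [Field K] [IsAlgClosed K] (φ : F →+* K)

theorem exists_simple_critical_value_of_pencil {ι : Type*} [Fintype ι] {n : ℕ} {f : ι → F[X]}
    (hd : ∀ j, (f j).natDegree ≤ n) (hf : ∀ j, derivative (derivative (f j)) ≠ 0)
    (hinj : Function.Injective f) (i : ι) :
    ∃ S : Finset F, S.card ≤ Fintype.card ι * ((2 * n - 1) * n) ∧ ∀ a ∉ S, ∃ β : K,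
      (criticalPoly (f i + C a * X)).eval₂ φ β = 0 ∧
      (derivative (criticalPoly (f i + C a * X))).eval₂ φ β ≠ 0 ∧
      ∀ j ≠ i, (criticalPoly (f j + C a * X)).eval₂ φ β ≠ 0 := by
  classical
  have hd' : ∀ j, ((f j).map φ).natDegree ≤ n := fun j => natDegree_map_le.trans (hd j)
  have hf' : ∀ j, derivative (derivative ((f j).map φ)) ≠ 0 := fun j => by
    rw [derivative_map, derivative_map]
    exact (Polynomial.map_ne_zero_iff φ.injective).2 (hf j)
  obtain ⟨W, hW0, hWd, hW⟩ := exists_eval_eq_zero_of_bitangent (hf' i) (hd' i)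
  have hV : ∀ j, ∃ V : K[X], V ≠ 0 ∧ V.natDegree ≤ (2 * n - 1) * n ∧ (j = i → V = W) ∧
      (j ≠ i → ∀ ρ σ, (derivative ((f j).map φ)).eval σ = (derivative ((f i).map φ)).eval ρ →
        ((f j).map φ - X * derivative ((f j).map φ)).eval σ =
          ((f i).map φ - X * derivative ((f i).map φ)).eval ρ → V.eval ρ = 0) := fun j => by
    by_cases hj : j = i
    · exact ⟨W, hW0, hWd, fun _ => rfl, fun h => absurd hj h⟩
    · obtain ⟨V, h1, h2, h3⟩ :=
        exists_eval_eq_zero_of_common_tangent (hf' i) (hf' j) (hd' i) (hd' j)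
        (fun h => hj (hinj (map_injective φ φ.injective h)).symm)
      exact ⟨V, h1, h2, fun h => absurd h hj, fun _ => h3⟩
  choose V hV0 hVd hVi hVj using hV
  let B : Finset K := Finset.univ.biUnion fun j =>
    (V j).roots.toFinset.image fun ρ => -(derivative ((f i).map φ)).eval ρ
  have hB : B.card ≤ Fintype.card ι * ((2 * n - 1) * n) := by
    refine Finset.card_biUnion_le_card_mul _ _ _ fun j _ => ?_
    exact Finset.card_image_le.trans ((Multiset.toFinset_card_le _).trans
      ((card_roots' _).trans (hVd j)))
  refine ⟨Finset.univ.filter fun a => φ a ∈ B, ?_, fun a ha => ?_⟩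
  · refine le_trans ?_ hB
    refine Finset.card_le_card_of_injOn φ (fun a ha => by simpa using ha) φ.injective.injOn
  have hder : ∀ j, (derivative (f j + C a * X)).map φ = derivative ((f j).map φ) + C (φ a) :=
    fun j => by simp [derivative_map]
  have hder0 : ∀ j, derivative (f j + C a * X) ≠ 0 := fun j h => hf j (by
    have := congrArg derivative h
    simpa using this)
  obtain ⟨ρ, hρ⟩ : ∃ ρ, (derivative ((f i).map φ) + C (φ a)).IsRoot ρ := by
    refine IsAlgClosed.exists_root _ fun h => ?_
    have h1 : (derivative ((f i).map φ) + C (φ a)).natDegree = 0 := natDegree_eq_of_degree_eq_some h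
    rw [natDegree_add_C] at h1
    exact (natDegree_pos_of_derivative_ne_zero (hf' i)).ne' h1
  have hρ' : (derivative ((f i).map φ)).eval ρ = -φ a := by
    rw [IsRoot.def, eval_add, eval_C] at hρ
    exact eq_neg_of_add_eq_zero_left hρ
  have hVρ : ∀ j, (V j).eval ρ ≠ 0 := fun j h => ha (by
    simp only [Finset.mem_filter, Finset.mem_univ, true_and, B, Finset.mem_biUnion,
      Finset.mem_image, Multiset.mem_toFinset]
    exact ⟨j, ρ, (mem_roots (hV0 j)).2 h, by rw [hρ', neg_neg]⟩)
  have hval : ∀ j σ, (derivative ((f j).map φ)).eval σ = -φ a →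
      ((f j).map φ - X * derivative ((f j).map φ)).eval σ = (f j + C a * X).eval₂ φ σ := by
    intro j σ h
    rw [eval_sub, eval_mul, h, eval_X, eval_map, eval₂_add, eval₂_mul, eval₂_C, eval₂_X]
    ring
  obtain ⟨g, hg⟩ := dvd_iff_isRoot.2 hρ
  have hgW : ∀ σ, g.eval σ = 0 → (derivative ((f i).map φ)).eval σ = -φ a := fun σ hσ => by
    have := congrArg (eval σ) hg
    rw [eval_add, eval_C, eval_mul, hσ, mul_zero] at this
    exact eq_neg_of_add_eq_zero_left this
  have hsimple := eval₂_criticalPoly_simple φ (hder0 i) (ρ := ρ) (g := g)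
    (by rw [hder, hg]) fun σ hσ h => hVρ i (by
      rw [hVi i rfl]
      refine hW ρ σ g ?_ hσ ?_
      · rw [← hg, hρ', C_neg, sub_neg_eq_add]
      · rw [hval i σ (hgW σ hσ), hval i ρ hρ', h])
  refine ⟨_, hsimple.1, hsimple.2, fun j hj =>
    eval₂_criticalPoly_ne_zero φ (hder0 j) fun σ hσ h => ?_⟩
  rw [← eval_map, hder, eval_add, eval_C] at hσ
  have hσ' := eq_neg_of_add_eq_zero_left hσ
  refine hVρ j (hVj j hj ρ σ (hσ'.trans hρ'.symm) ?_)
  rw [hval j σ hσ', hval i ρ hρ', h, neg_neg]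

end Pencil

theorem abs_sum_prod_mu_add_C_le {F : Type} [Field F] [Fintype F] {K : Type*} [Field K]
    (φ : F →+* K) (hq : Odd (Fintype.card F)) {r n : ℕ} (hr : 2 ≤ r) (hn : 2 ≤ n)
    (hbig : (2 * r * n) ^ 2 ≤ Fintype.card F) {ε : Fin r → ℕ} (hε : ∀ j, ε j = 1 ∨ ε j = 2)
    {f : Fin r → F[X]} (hm : ∀ j, (f j).Monic) (hd : ∀ j, (f j).natDegree = n)
    {i : Fin r} (hi : ε i = 1) {β : K} (h0 : (criticalPoly (f i)).eval₂ φ β = 0)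
    (h1 : (derivative (criticalPoly (f i))).eval₂ φ β ≠ 0)
    (h2 : ∀ j ≠ i, (criticalPoly (f j)).eval₂ φ β ≠ 0) :
    |∑ t : F, ∏ j, mu (f j + C t) ^ ε j| ≤ 2 * r * n * √(Fintype.card F) := by
  classical
  set q := Fintype.card F
  choose c hc hmu using fun j => exists_mu_add_C_eq hq (hm j) (by rw [hd j]; omega)
  have hQd : ∀ j, (criticalPoly (f j)).natDegree ≤ n - 1 := fun j =>
    (natDegree_criticalPoly_le _).trans ((natDegree_derivative_le _).trans (by rw [hd j]))
  have hQ0 : ∀ j, criticalPoly (f j) ≠ 0 := fun j h => by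
    by_cases hj : j = i
    · subst hj; simp [h] at h1
    · exact h2 j hj (by simp [h])
  set I := Finset.univ.filter fun j => ε j = 1
  set J := Finset.univ.filter fun j => ¬ ε j = 1
  have hIJ : I.card + J.card = r := by
    rw [Finset.card_filter_add_card_filter_not]; simp
  have hiI : i ∈ I := by simp [I, hi]
  have hIpos : 1 ≤ I.card := Finset.card_pos.2 ⟨i, hiI⟩
  set P := ∏ j ∈ I, criticalPoly (f j)
  have hPi : P = criticalPoly (f i) * ∏ j ∈ I.erase i, criticalPoly (f j) :=
    (Finset.mul_prod_erase _ _ hiI).symm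
  have hPd : P.natDegree ≤ I.card * (n - 1) :=
    (natDegree_prod_le _ _).trans
      ((Finset.sum_le_card_nsmul _ _ _ fun j _ => hQd j).trans (by simp))
  have hP0 : P.eval₂ φ β = 0 := by rw [hPi, eval₂_mul, h0, zero_mul]
  have hP1 : (derivative P).eval₂ φ β ≠ 0 := by
    rw [hPi, derivative_mul, eval₂_add, eval₂_mul, eval₂_mul, h0, zero_mul, add_zero]
    refine mul_ne_zero h1 ?_
    rw [← coe_eval₂RingHom, map_prod]
    exact Finset.prod_ne_zero_iff.2 fun j hj => h2 j (Finset.ne_of_mem_erase hj)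
  have hrn : I.card * (n - 1) ≤ r * (n - 1) := Nat.mul_le_mul_right _ (by omega)
  obtain ⟨m, rfl⟩ : ∃ m, n = m + 1 := ⟨n - 1, by omega⟩
  rw [Nat.add_sub_cancel] at hPd hrn hQd
  have hq4 : 4 * (P.natDegree + 2) ^ 2 ≤ q := by
    refine le_trans ?_ hbig
    have : P.natDegree + 2 ≤ r * (m + 1) := by nlinarith
    calc 4 * (P.natDegree + 2) ^ 2 ≤ 4 * (r * (m + 1)) ^ 2 := by gcongr
      _ = _ := by ring
  have hS := abs_sum_quadraticChar_eval_le φ hq β hP0 hP1 hq4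
  set T := J.biUnion fun j => (criticalPoly (f j)).roots.toFinset
  have hT : T.card ≤ J.card * m := Finset.card_biUnion_le_card_mul _ _ _ fun j _ =>
    (Multiset.toFinset_card_le _).trans ((card_roots' _).trans (hQd j))
  have hterm : ∀ t : F, ∏ j, mu (f j + C t) ^ ε j =
      ((∏ j ∈ I, c j : ℤ) : ℝ) * ((quadraticChar F (P.eval t) : ℤ) : ℝ) -
        if t ∈ T then ((∏ j ∈ I, c j : ℤ) : ℝ) * ((quadraticChar F (P.eval t) : ℤ) : ℝ) else 0 := by
    intro t
    rw [← Finset.prod_filter_mul_prod_filter_not Finset.univ fun j => ε j = 1]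
    have e1 : ∏ j ∈ I, mu (f j + C t) ^ ε j =
        ((∏ j ∈ I, c j : ℤ) : ℝ) * ((quadraticChar F (P.eval t) : ℤ) : ℝ) := by
      rw [eval_prod, map_prod, ← Int.cast_mul, ← Finset.prod_mul_distrib, Int.cast_prod]
      refine Finset.prod_congr rfl fun j hj => ?_
      rw [(Finset.mem_filter.1 hj).2, pow_one, hmu]
    have e2 : ∏ j ∈ J, mu (f j + C t) ^ ε j = if t ∈ T then 0 else 1 := by
      have e3 : ∀ j ∈ J, mu (f j + C t) ^ ε j =
          if (criticalPoly (f j)).eval t = 0 then 0 else 1 := fun j hj => by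
        rw [(hε j).resolve_left (Finset.mem_filter.1 hj).2, hmu]
        split_ifs with h
        · simp [h]
        · have hc2 : c j ^ 2 = 1 := by rw [← sq_abs, hc, one_pow]
          rw [← Int.cast_pow, mul_pow, hc2, ← map_pow, map_pow, quadraticChar_sq_one h]
          simp
      split_ifs with h
      · obtain ⟨j, hj, ht⟩ := Finset.mem_biUnion.1 h
        rw [Multiset.mem_toFinset, mem_roots (hQ0 j)] at ht
        exact Finset.prod_eq_zero hj (by rw [e3 j hj, if_pos (show eval t _ = 0 from ht)])
      · refine Finset.prod_eq_one fun j hj => ?_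
        rw [e3 j hj, if_neg]
        intro ht
        refine h (Finset.mem_biUnion.2 ⟨j, hj, ?_⟩)
        rw [Multiset.mem_toFinset, mem_roots (hQ0 j)]
        exact ht
    rw [e1, e2]
    split_ifs <;> simp
  have hcI : |((∏ j ∈ I, c j : ℤ) : ℝ)| = 1 := by
    rw [← Int.cast_abs, Finset.abs_prod, Finset.prod_congr rfl fun j _ => hc j]
    simp
  rw [Finset.sum_congr rfl fun t _ => hterm t, Finset.sum_sub_distrib, ← Finset.mul_sum]
  have hT' : |∑ t : F, if t ∈ T then
      ((∏ j ∈ I, c j : ℤ) : ℝ) * ((quadraticChar F (P.eval t) : ℤ) : ℝ) else 0| ≤ T.card := by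
    rw [Finset.sum_ite_mem, Finset.univ_inter]
    refine (Finset.abs_sum_le_sum_abs _ _).trans
      ((Finset.sum_le_card_nsmul _ _ 1 fun t _ => ?_).trans (by simp))
    rw [abs_mul, hcI, one_mul]
    rcases quadraticChar_isQuadratic F (P.eval t) with h | h | h <;> simp [h]
  refine (abs_sub _ _).trans ?_
  rw [abs_mul, hcI, one_mul, ← Int.cast_sum]
  have hQ : (2 * r * (m + 1) : ℝ) ≤ √q := Real.le_sqrt_of_sq_le (by exact_mod_cast hbig)
  have hPd' : (P.natDegree : ℝ) ≤ I.card * m := by exact_mod_cast hPd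
  have hT'' : (T.card : ℝ) ≤ J.card * m := by exact_mod_cast hT
  have hIJ' : (I.card + J.card : ℝ) = r := by exact_mod_cast hIJ
  have hr' : (2 : ℝ) ≤ r := by exact_mod_cast hr
  have hT3 := hT'.trans hT''
  push_cast at hS hT3 ⊢
  have hm0 : (0 : ℝ) ≤ m := by positivity
  have hs0 : (0 : ℝ) ≤ √q := by positivity
  have hI0 : (0 : ℝ) ≤ I.card := by positivity
  have hJ0 : (0 : ℝ) ≤ J.card := by positivity
  have a1 : (2 * P.natDegree * √q + 8 * P.natDegree : ℝ) ≤
      2 * (I.card * m) * √q + 8 * (I.card * m) := by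
    gcongr
  have a2 : (I.card * m : ℝ) * √q ≤ r * m * √q := by
    gcongr; linarith
  have a3 : (8 * (I.card * m) + J.card * m : ℝ) ≤ 8 * (r * m) := by
    rw [← hIJ']; nlinarith [mul_nonneg hJ0 hm0]
  have a4 : (8 * (r * m) : ℝ) ≤ 2 * r * √q := by
    nlinarith
  have hS' := hS.trans a1
  have a5 : (2 * r * (m + 1) * √q : ℝ) = 2 * (r * m * √q) + 2 * r * √q := by ring
  linarith

end Polynomial

theorem mon_add_single {F : Type} [Field F] {n : ℕ} (a : Fin n → F) (e : Fin n) (t : F) :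
    mon n (a + Pi.single e t) = mon n a + C t * X ^ (e : ℕ) := by
  classical
  have h : ∑ i : Fin n, C ((Pi.single e t : Fin n → F) i) * X ^ (i : ℕ) = C t * X ^ (e : ℕ) := by
    rw [Finset.sum_eq_single e (fun i _ hi => by simp [hi]) (by simp)]
    simp
  simp only [mon, Pi.add_apply, C_add, add_mul, Finset.sum_add_distrib, h, add_assoc]

theorem natDegree_sum_C_mul_X_pow_lt {F : Type} [Field F] {n : ℕ} (a : Fin n → F)
    {g : F[X]} (hg : g.natDegree < n) :
    (∑ i : Fin n, C (a i) * X ^ (i : ℕ) + g).natDegree < n := by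
  refine (natDegree_add_le _ _).trans_lt (max_lt ?_ hg)
  refine Nat.lt_of_le_pred (by omega) (natDegree_sum_le_of_forall_le _ _ fun i _ => ?_)
  exact (natDegree_C_mul_X_pow_le _ _).trans (Nat.le_pred_of_lt i.2)

theorem monic_mon_add {F : Type} [Field F] {n : ℕ} (a : Fin n → F) {g : F[X]}
    (hg : g.natDegree < n) : (mon n a + g).Monic := by
  rw [mon, add_assoc]
  exact monic_X_pow_add
    (degree_le_natDegree.trans_lt (by exact_mod_cast natDegree_sum_C_mul_X_pow_lt a hg))

theorem natDegree_mon_add {F : Type} [Field F] {n : ℕ} (a : Fin n → F) {g : F[X]}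
    (hg : g.natDegree < n) : (mon n a + g).natDegree = n := by
  rw [mon, add_assoc, natDegree_add_eq_left_of_natDegree_lt, natDegree_X_pow]
  rw [natDegree_X_pow]
  exact natDegree_sum_C_mul_X_pow_lt a hg

theorem abs_mu_le_one {F : Type} [Field F] (f : F[X]) : |mu f| ≤ 1 := by
  unfold mu
  split_ifs <;> simp

theorem abs_prod_mu_pow_le_one {F : Type} [Field F] {r : ℕ} (f : Fin r → F[X]) (ε : Fin r → ℕ) :
    |∏ j, mu (f j) ^ ε j| ≤ 1 := by
  rw [Finset.abs_prod]
  refine Finset.prod_le_one (fun j _ => abs_nonneg _) fun j _ => ?_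
  rw [abs_pow]
  exact pow_le_one₀ (abs_nonneg _) (abs_mu_le_one _)

/-- Summing over all functions equals averaging over all lines in a coordinate direction. -/
theorem sum_sum_add_single {F M : Type*} [AddGroup F] [Fintype F] [AddCommMonoid M]
    {n : ℕ} (e : Fin n) (G : (Fin n → F) → M) :
    ∑ a, ∑ t : F, G (a + (Pi.single e t : Fin n → F)) = Fintype.card F • ∑ a, G a := by
  have h : ∀ t : F, ∑ a, G (a + (Pi.single e t : Fin n → F)) = ∑ a, G a := fun t =>
    Equiv.sum_comp (Equiv.addRight (Pi.single e t : Fin n → F)) G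
  rw [Finset.sum_comm, Finset.sum_congr rfl fun t _ => h t]
  simp

theorem card_mul_card_filter_le {F : Type*} [AddGroup F] [Fintype F]
    {n k : ℕ} (e : Fin n) (p : (Fin n → F) → Prop) [DecidablePred p]
    (h : ∀ a, (Finset.univ.filter fun t : F => p (a + (Pi.single e t : Fin n → F))).card ≤ k) :
    Fintype.card F * (Finset.univ.filter p).card ≤ Fintype.card F ^ n * k := by
  classical
  have := sum_sum_add_single e fun a => if p a then 1 else 0
  rw [← Finset.card_filter, smul_eq_mul] at this
  rw [← this]
  simp only [← Finset.card_filter]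
  refine (Finset.sum_le_card_nsmul _ _ k fun a _ => h a).trans_eq ?_
  simp

theorem card_filter_exists_derivative_eq_zero_le {F : Type} [Field F] [Fintype F]
    [DecidableEq F] (h2 : (2 : F) ≠ 0) {r n : ℕ} (hn : 2 ≤ n)
    {α : Fin r → F[X]} (hdeg : ∀ j, (α j).natDegree < n) :
    Fintype.card F * (Finset.univ.filter fun a : Fin n → F =>
      ∃ j, derivative (derivative (mon n a + α j)) = 0).card ≤ Fintype.card F ^ n * r := by
  classical
  have hc : ∀ g : F[X], derivative (derivative g) = 0 → g.coeff 2 = 0 := fun g hg => by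
    have := congrArg (fun p => coeff p 0) hg
    simp only [coeff_derivative, coeff_zero] at this
    norm_num at this
    exact this.resolve_right h2
  rcases hn.eq_or_lt with rfl | hn
  · rw [Finset.filter_false_of_mem, Finset.card_empty, mul_zero]
    · exact Nat.zero_le _
    · rintro a - ⟨j, hj⟩
      have := (monic_mon_add a (hdeg j)).coeff_natDegree
      rw [natDegree_mon_add a (hdeg j), hc _ hj] at this
      exact zero_ne_one this
  · refine card_mul_card_filter_le ⟨2, hn⟩ _ fun a => ?_
    have hsub : (Finset.univ.filter fun t : F => ∃ j, derivative (derivative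
        (mon n (a + Pi.single ⟨2, hn⟩ t) + α j)) = 0) ⊆
        Finset.univ.image fun j => -(mon n a + α j).coeff 2 := by
      intro t ht
      obtain ⟨j, hj⟩ := (Finset.mem_filter.1 ht).2
      have := hc _ hj
      rw [mon_add_single, add_right_comm, coeff_add, coeff_C_mul_X_pow] at this
      refine Finset.mem_image.2 ⟨j, Finset.mem_univ _, ?_⟩
      simpa using neg_eq_of_add_eq_zero_right this
    refine (Finset.card_le_card hsub).trans (Finset.card_image_le.trans ?_)
    simp

/-- Over the field `K`, `P i` has a simple root which is not a root of any other `P j`. -/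
def HasIsolatedSimpleRoot {F K : Type*} [Field F] [Field K] (φ : F →+* K) {ι : Type*}
    (P : ι → F[X]) (i : ι) : Prop :=
  ∃ β : K, (P i).eval₂ φ β = 0 ∧ (derivative (P i)).eval₂ φ β ≠ 0 ∧
    ∀ j ≠ i, (P j).eval₂ φ β ≠ 0

theorem card_filter_not_hasIsolatedSimpleRoot_le {F : Type} [Field F] [Fintype F]
    {K : Type*} [Field K] [IsAlgClosed K] (φ : F →+* K) (h2 : (2 : F) ≠ 0) {r n : ℕ} (hn : 2 ≤ n)
    {α : Fin r → F[X]} (hα : Function.Injective α) (hdeg : ∀ j, (α j).natDegree < n) (i : Fin r)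
    [DecidablePred fun a : Fin n → F =>
      ¬ HasIsolatedSimpleRoot φ (fun j => criticalPoly (mon n a + α j)) i] :
    Fintype.card F * (Finset.univ.filter fun a : Fin n → F =>
      ¬ HasIsolatedSimpleRoot φ (fun j => criticalPoly (mon n a + α j)) i).card ≤
        Fintype.card F ^ n * (3 * r * n ^ 2) := by
  classical
  have hB₁ := card_filter_exists_derivative_eq_zero_le h2 hn hdeg
  have hB₂ := card_mul_card_filter_le (k := r * ((2 * n - 1) * n)) (⟨1, hn⟩ : Fin n)
    (fun a : Fin n → F => (∀ j, derivative (derivative (mon n a + α j)) ≠ 0) ∧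
      ¬ HasIsolatedSimpleRoot φ (fun j => criticalPoly (mon n a + α j)) i) fun a => by
    by_cases ha : ∀ j, derivative (derivative (mon n a + α j)) ≠ 0
    · obtain ⟨S, hS, hS'⟩ := exists_simple_critical_value_of_pencil φ
        (fun j => (natDegree_mon_add a (hdeg j)).le) ha
        (fun j k h => hα (add_left_cancel h)) i
      rw [Fintype.card_fin] at hS
      refine (Finset.card_le_card fun t ht => ?_).trans hS
      by_contra htS
      refine (Finset.mem_filter.1 ht).2.2 ?_
      simp only [HasIsolatedSimpleRoot, mon_add_single, pow_one, add_right_comm (mon n a)]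
      exact hS' t htS
    · rw [Finset.filter_false_of_mem, Finset.card_empty]
      · exact Nat.zero_le _
      · rintro t - ⟨h, -⟩
        refine ha fun j => ?_
        have := h j
        rw [mon_add_single, add_right_comm] at this
        simpa using this
  have hsub := Finset.card_le_card (s := Finset.univ.filter fun a : Fin n → F =>
      ¬ HasIsolatedSimpleRoot φ (fun j => criticalPoly (mon n a + α j)) i)
    (t := (Finset.univ.filter fun a : Fin n → F =>
      ∃ j, derivative (derivative (mon n a + α j)) = 0) ∪
      Finset.univ.filter fun a : Fin n → F =>
        (∀ j, derivative (derivative (mon n a + α j)) ≠ 0) ∧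
          ¬ HasIsolatedSimpleRoot φ (fun j => criticalPoly (mon n a + α j)) i) fun a ha => by
    simp only [Finset.mem_union, Finset.mem_filter, Finset.mem_univ, true_and] at ha ⊢
    by_cases h : ∃ j, derivative (derivative (mon n a + α j)) = 0
    · exact Or.inl h
    · exact Or.inr ⟨not_exists.1 h, ha⟩
  have hk : r + r * ((2 * n - 1) * n) ≤ 3 * r * n ^ 2 := by
    have : 1 + (2 * n - 1) * n ≤ 3 * n ^ 2 := by
      have : (2 * n - 1) * n ≤ 2 * n * n := Nat.mul_le_mul_right _ (Nat.sub_le _ _)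
      nlinarith
    calc r + r * ((2 * n - 1) * n) = r * (1 + (2 * n - 1) * n) := by ring
      _ ≤ r * (3 * n ^ 2) := Nat.mul_le_mul_left _ this
      _ = _ := by ring
  calc _ ≤ _ := Nat.mul_le_mul_left _ (hsub.trans (Finset.card_union_le _ _))
    _ ≤ Fintype.card F ^ n * r + Fintype.card F ^ n * (r * ((2 * n - 1) * n)) := by
      rw [mul_add]; exact add_le_add hB₁ hB₂
    _ ≤ _ := by rw [← mul_add]; exact Nat.mul_le_mul_left _ hk

/-- The function field Chowla conjecture (Carmon–Rudnick): for an odd prime power `q`,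
`r ≥ 2`, `n ≥ 2`, distinct `α₁, …, α_r ∈ F_q[T]` with `deg α_j < n`, and
`ε₁, …, ε_r ∈ {1,2}` not all even,
`|∑_{f ∈ Mₙ} μ(f+α₁)^{ε₁} ⋯ μ(f+α_r)^{ε_r}| ≤ 2rn q^{n−1/2} + 3rn² q^{n−1}`. -/
theorem chowla_function_field (F : Type) [Field F] [Fintype F]
    (hq : Odd (Fintype.card F)) (r n : ℕ) (hr : 2 ≤ r) (hn : 2 ≤ n)
    (α : Fin r → F[X]) (hα : Function.Injective α)
    (hdeg : ∀ j, (α j).natDegree < n)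
    (ε : Fin r → ℕ) (hε : ∀ j, ε j = 1 ∨ ε j = 2) (hodd : ∃ j, ε j = 1) :
    |∑ a : Fin n → F, ∏ j : Fin r, mu (mon n a + α j) ^ ε j| ≤
      2 * r * n * (Fintype.card F : ℝ) ^ ((n : ℝ) - 1 / 2) +
        3 * r * n ^ 2 * (Fintype.card F : ℝ) ^ ((n : ℝ) - 1) := by
  classical
  obtain ⟨i, hi⟩ := hodd
  have h2 : (2 : F) ≠ 0 := Ring.two_ne_zero fun h => by
    have := FiniteField.even_card_of_char_two h
    rw [Nat.odd_iff] at hq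
    omega
  set S := ∑ a : Fin n → F, ∏ j : Fin r, mu (mon n a + α j) ^ ε j with hSdef
  have hbad := card_filter_not_hasIsolatedSimpleRoot_le (algebraMap F (AlgebraicClosure F))
    h2 hn hα hdeg i
  set B := Finset.univ.filter fun a : Fin n → F => ¬ HasIsolatedSimpleRoot
    (algebraMap F (AlgebraicClosure F)) (fun j => criticalPoly (mon n a + α j)) i
  set q := Fintype.card F with hqdef
  have hq0 : (0 : ℝ) < q := by exact_mod_cast Fintype.card_pos
  have hs0 : 0 < √(q : ℝ) := Real.sqrt_pos.2 hq0
  have hss : √(q : ℝ) * √(q : ℝ) = q := Real.mul_self_sqrt hq0.le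
  have hp1 : (q : ℝ) ^ ((n : ℝ) - 1) * q = q ^ n := by
    rw [← Real.rpow_natCast, ← Real.rpow_add_one hq0.ne', sub_add_cancel]
  have hp2 : (q : ℝ) ^ ((n : ℝ) - 1 / 2) * √(q : ℝ) = q ^ n := by
    rw [Real.sqrt_eq_rpow, ← Real.rpow_natCast, ← Real.rpow_add hq0, sub_add_cancel]
  by_cases hbig : (2 * r * n) ^ 2 ≤ q
  · have hline : ∀ a : Fin n → F, |∑ t : F, ∏ j,
        mu (mon n (a + Pi.single (⟨0, by omega⟩ : Fin n) t) + α j) ^ ε j| ≤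
          2 * r * n * √(q : ℝ) + if a ∈ B then (q : ℝ) else 0 := fun a => by
      split_ifs with ha
      · refine le_add_of_nonneg_of_le (by positivity) ?_
        refine (Finset.abs_sum_le_sum_abs _ _).trans ((Finset.sum_le_card_nsmul _ _ 1 fun t _ =>
          abs_prod_mu_pow_le_one _ _).trans (by simp [hqdef]))
      · simp only [B, Finset.mem_filter, Finset.mem_univ, true_and, not_not] at ha
        obtain ⟨β, h0, h1, h2⟩ := ha
        simp only [mon_add_single, pow_zero, mul_one, add_right_comm (mon n a), add_zero]
        exact abs_sum_prod_mu_add_C_le _ hq hr hn hbig hε (fun j => monic_mon_add a (hdeg j))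
          (fun j => natDegree_mon_add a (hdeg j)) hi h0 h1 h2
    have hsum : (q : ℝ) * |S| ≤ q ^ n * (2 * r * n * √(q : ℝ)) + q * B.card := by
      have := sum_sum_add_single (⟨0, by omega⟩ : Fin n) fun a : Fin n → F =>
        ∏ j : Fin r, mu (mon n a + α j) ^ ε j
      rw [← hSdef, nsmul_eq_mul] at this
      calc (q : ℝ) * |S| = |(q : ℝ) * S| := by rw [abs_mul, Nat.abs_cast]
        _ ≤ ∑ a : Fin n → F, (2 * r * n * √(q : ℝ) + if a ∈ B then (q : ℝ) else 0) := by
          rw [← this]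
          exact (Finset.abs_sum_le_sum_abs _ _).trans (Finset.sum_le_sum fun a _ => hline a)
        _ = _ := by
          rw [Finset.sum_add_distrib, Finset.sum_ite_mem]
          simp [← hqdef, mul_comm]
    have hbad' : (q : ℝ) * B.card ≤ q ^ n * (3 * r * n ^ 2) := by exact_mod_cast hbad
    refine le_of_mul_le_mul_left ?_ hq0
    calc (q : ℝ) * |S| ≤ q ^ n * (2 * r * n * √(q : ℝ)) + q ^ n * (3 * r * n ^ 2) := by linarith
      _ = _ := by
        nth_rewrite 1 [← hp2]
        rw [← hp1]
        linear_combination (2 * r * n * (q : ℝ) ^ ((n : ℝ) - 1 / 2)) * hss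
  · have hsmall : √(q : ℝ) ≤ 2 * r * n :=
      Real.sqrt_le_left (by positivity) |>.2 (by exact_mod_cast (not_le.1 hbig).le)
    refine le_add_of_le_of_nonneg ?_ (by positivity)
    calc |S| ≤ q ^ n := by
          refine (Finset.abs_sum_le_sum_abs _ _).trans ((Finset.sum_le_card_nsmul _ _ 1 fun t _ =>
            abs_prod_mu_pow_le_one _ _).trans (by simp [hqdef]))
      _ = √(q : ℝ) * (q : ℝ) ^ ((n : ℝ) - 1 / 2) := by rw [← hp2, mul_comm]
      _ ≤ _ := by gcongr
end

section
/- For every prime power q and every integer n ≥ 1, ∑_{f ∈ M_n} d(f)^2 = binom(n+3,3)·q^n − binom(n+1,3)·q^{n−1}. -/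
open Polynomial

/-- `d(f)`: the number of monic divisors of `f`. -/
noncomputable def dd {F : Type} [Field F] (f : F[X]) : ℕ :=
  Nat.card {g : F[X] // g.Monic ∧ g ∣ f}

/-- The finset of monic polynomials of degree `n`. -/
noncomputable def monics (F : Type) [Field F] [Fintype F] (n : ℕ) : Finset F[X] := by
  classical exact Finset.univ.image (mon (F := F) n)

theorem mon_coeff {F : Type} [Field F] {n : ℕ} (a : Fin n → F) (i : Fin n) :
    (mon n a).coeff i = a i := by
  have hi : (i : ℕ) ≠ n := i.2.ne
  simp [mon, coeff_X_pow, hi, ← Fin.ext_iff]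

theorem mon_injective {F : Type} [Field F] (n : ℕ) : Function.Injective (mon (F := F) n) :=
  fun a b h => funext fun i => by rw [← mon_coeff a i, h, mon_coeff]

theorem degree_mon_lower {F : Type} [Field F] {n : ℕ} (a : Fin n → F) :
    (∑ i : Fin n, C (a i) * X ^ (i : ℕ) : F[X]).degree < (n : WithBot ℕ) :=
  degree_sum_fin_lt a

theorem monic_mon {F : Type} [Field F] {n : ℕ} (a : Fin n → F) : (mon n a).Monic :=
  monic_X_pow_add (degree_mon_lower a)

theorem natDegree_mon {F : Type} [Field F] {n : ℕ} (a : Fin n → F) :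
    (mon n a).natDegree = n := by
  refine natDegree_eq_of_degree_eq_some ?_
  rw [mon, degree_add_eq_left_of_degree_lt] <;> rw [degree_X_pow]
  exact degree_mon_lower a

theorem mem_monics {F : Type} [Field F] [Fintype F] {n : ℕ} {f : F[X]} :
    f ∈ monics F n ↔ f.Monic ∧ f.natDegree = n := by
  classical
  simp only [monics, Finset.mem_image, Finset.mem_univ, true_and]
  constructor
  · rintro ⟨a, rfl⟩
    exact ⟨monic_mon a, natDegree_mon a⟩
  · rintro ⟨hf, rfl⟩
    refine ⟨fun i => f.coeff i, ?_⟩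
    conv_rhs => rw [hf.as_sum]
    rw [mon, Fin.sum_univ_eq_sum_range (fun i => C (f.coeff i) * X ^ i)]

theorem card_monics (F : Type) [Field F] [Fintype F] (n : ℕ) :
    (monics F n).card = Fintype.card F ^ n := by
  classical
  rw [monics, Finset.card_image_of_injective _ (mon_injective n)]
  simp

/-- The graded product of two sequences of finsets. -/
noncomputable def gradedProd {α β : Type} (A : ℕ → Finset α) (B : ℕ → Finset β) (n : ℕ) :
    Finset (α × β) := by
  classical exact (Finset.HasAntidiagonal.antidiagonal n).biUnion fun p => A p.1 ×ˢ B p.2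

theorem mem_gradedProd {α β : Type} {A : ℕ → Finset α} {B : ℕ → Finset β} {n : ℕ} {x : α × β} :
    x ∈ gradedProd A B n ↔ ∃ i j, i + j = n ∧ x.1 ∈ A i ∧ x.2 ∈ B j := by
  simp [gradedProd]

theorem card_gradedProd {α β : Type} {A : ℕ → Finset α} (B : ℕ → Finset β)
    (hA : ∀ i j x, x ∈ A i → x ∈ A j → i = j) (n : ℕ) :
    (gradedProd A B n).card = ∑ p ∈ Finset.HasAntidiagonal.antidiagonal n,
        (A p.1).card * (B p.2).card := by
  classical
  rw [gradedProd, Finset.card_biUnion]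
  · simp
  · rintro ⟨i, j⟩ hp ⟨i', j'⟩ hp' hne
    rw [Function.onFun, Finset.disjoint_left]
    rintro ⟨x, y⟩ h h'
    simp only [Finset.mem_product, Finset.mem_coe, Finset.HasAntidiagonal.mem_antidiagonal]
      at h h' hp hp'
    have := hA _ _ _ h.1 h'.1
    exact hne (by simp only [Prod.mk.injEq]; omega)

/-- Pairs of monic polynomials with total degree `n`. -/
noncomputable def monicPairs (F : Type) [Field F] [Fintype F] (n : ℕ) : Finset (F[X] × F[X]) :=
  gradedProd (monics F) (monics F) n

theorem mem_monicPairs {F : Type} [Field F] [Fintype F] {n : ℕ} {x : F[X] × F[X]} :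
    x ∈ monicPairs F n ↔ x.1.Monic ∧ x.2.Monic ∧ x.1.natDegree + x.2.natDegree = n := by
  simp only [monicPairs, mem_gradedProd, mem_monics]
  constructor
  · rintro ⟨i, j, rfl, ⟨h1, rfl⟩, h2, rfl⟩
    exact ⟨h1, h2, rfl⟩
  · rintro ⟨h1, h2, h⟩
    exact ⟨_, _, h, ⟨h1, rfl⟩, h2, rfl⟩

theorem card_monicPairs (F : Type) [Field F] [Fintype F] (n : ℕ) :
    (monicPairs F n).card = (n + 1) * Fintype.card F ^ n := by
  rw [monicPairs, card_gradedProd _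
    (fun _ _ _ hi hj => (mem_monics.1 hi).2.symm.trans (mem_monics.1 hj).2)]
  simp only [card_monics]
  rw [Finset.sum_congr rfl (g := fun _ => Fintype.card F ^ n)]
  · simp
  · intro p hp
    rw [← pow_add, Finset.HasAntidiagonal.mem_antidiagonal.1 hp]

/-- Pairs of coprime monic polynomials with total degree `n`. -/
noncomputable def coprimePairs (F : Type) [Field F] [Fintype F] (n : ℕ) :
    Finset (F[X] × F[X]) := by
  classical exact (monicPairs F n).filter fun x => IsCoprime x.1 x.2

theorem mem_coprimePairs {F : Type} [Field F] [Fintype F] {n : ℕ} {x : F[X] × F[X]} :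
    x ∈ coprimePairs F n ↔
      x.1.Monic ∧ x.2.Monic ∧ x.1.natDegree + x.2.natDegree = n ∧ IsCoprime x.1 x.2 := by
  simp [coprimePairs, mem_monicPairs, and_assoc]

theorem exists_monic_gcd_decomposition {F : Type} [Field F] {g h : F[X]} (hg : g.Monic)
    (hh : h.Monic) :
    ∃ d a b : F[X], d.Monic ∧ a.Monic ∧ b.Monic ∧ IsCoprime a b ∧ d * a = g ∧ d * b = h := by
  classical
  set e := EuclideanDomain.gcd g h with he
  have he0 : e ≠ 0 := fun h0 => hg.ne_zero (EuclideanDomain.gcd_eq_zero_iff.1 h0).1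
  have hd : (normalize e).Monic := monic_normalize he0
  obtain ⟨a, ha⟩ : normalize e ∣ g :=
    normalize_dvd_iff.2 (EuclideanDomain.gcd_dvd_left g h)
  obtain ⟨b, hb⟩ : normalize e ∣ h :=
    normalize_dvd_iff.2 (EuclideanDomain.gcd_dvd_right g h)
  refine ⟨normalize e, a, b, hd, hd.of_mul_monic_left (ha ▸ hg), hd.of_mul_monic_left (hb ▸ hh),
    ?_, ha.symm, hb.symm⟩
  obtain ⟨w, hw⟩ : e ∣ normalize e := dvd_normalize_iff.2 dvd_rfl
  refine ⟨EuclideanDomain.gcdA g h * w, EuclideanDomain.gcdB g h * w, ?_⟩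
  apply mul_left_cancel₀ hd.ne_zero
  have hbez := EuclideanDomain.gcd_eq_gcd_ab g h
  rw [← he] at hbez
  calc _ = (normalize e * a * EuclideanDomain.gcdA g h
        + normalize e * b * EuclideanDomain.gcdB g h) * w := by ring
    _ = e * w := by rw [← ha, ← hb, ← hbez]
    _ = _ := by rw [← hw, mul_one]

theorem dvd_of_coprime_decomposition {R : Type*} [CommRing R] {d a b d' a' b' : R}
    (h : IsCoprime a' b') (ha : d * a = d' * a') (hb : d * b = d' * b') : d ∣ d' := by
  obtain ⟨u, v, huv⟩ := h
  refine ⟨u * a + v * b, ?_⟩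
  linear_combination -d' * huv - u * ha - v * hb

theorem monic_gcd_decomposition_unique {F : Type} [Field F] {d a b d' a' b' : F[X]}
    (hd : d.Monic) (hd' : d'.Monic) (h : IsCoprime a b) (h' : IsCoprime a' b')
    (ha : d * a = d' * a') (hb : d * b = d' * b') : d = d' ∧ a = a' ∧ b = b' := by
  have hdd : d = d' := eq_of_monic_of_associated hd hd'
    (associated_of_dvd_dvd (dvd_of_coprime_decomposition h' ha hb)
      (dvd_of_coprime_decomposition h ha.symm hb.symm))
  subst hdd
  exact ⟨rfl, mul_left_cancel₀ hd.ne_zero ha, mul_left_cancel₀ hd.ne_zero hb⟩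

theorem card_monicPairs_eq_sum_coprimePairs (F : Type) [Field F] [Fintype F] (n : ℕ) :
    (monicPairs F n).card =
      ∑ j ∈ Finset.range (n / 2 + 1), Fintype.card F ^ j * (coprimePairs F (n - 2 * j)).card := by
  classical
  have hdisj : Set.PairwiseDisjoint (↑(Finset.range (n / 2 + 1)))
      (fun j => monics F j ×ˢ coprimePairs F (n - 2 * j)) := by
    intro i _ j _ hij
    rw [Function.onFun, Finset.disjoint_left]
    intro x hi hj
    rw [Finset.mem_product, mem_monics] at hi hj
    exact hij (hi.1.2.symm.trans hj.1.2)
  simp_rw [← card_monics, ← Finset.card_product]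
  rw [← Finset.card_biUnion hdisj]
  symm
  refine Finset.card_bij (fun x _ => (x.1 * x.2.1, x.1 * x.2.2)) ?_ ?_ ?_
  · rintro ⟨e, a, b⟩ hx
    simp only [Finset.mem_biUnion, Finset.mem_range, Finset.mem_product, mem_monics,
      mem_coprimePairs] at hx
    obtain ⟨j, hj, ⟨he, hej⟩, ha, hb, hab, -⟩ := hx
    refine mem_monicPairs.2 ⟨he.mul ha, he.mul hb, ?_⟩
    simp only [he.natDegree_mul ha, he.natDegree_mul hb]
    omega
  · rintro ⟨e, a, b⟩ hx ⟨e', a', b'⟩ hx' h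
    simp only [Finset.mem_biUnion, Finset.mem_range, Finset.mem_product, mem_monics,
      mem_coprimePairs] at hx hx'
    obtain ⟨j, hj, ⟨he, -⟩, -, -, -, hab⟩ := hx
    obtain ⟨j', hj', ⟨he', -⟩, -, -, -, hab'⟩ := hx'
    simp only [Prod.mk.injEq] at h ⊢
    exact monic_gcd_decomposition_unique he he' hab hab' h.1 h.2
  · rintro ⟨g, h⟩ hx
    obtain ⟨hg, hh, hn⟩ := mem_monicPairs.1 hx
    obtain ⟨d, a, b, hd, ha, hb, hab, rfl, rfl⟩ := exists_monic_gcd_decomposition hg hh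
    simp only [hd.natDegree_mul ha, hd.natDegree_mul hb] at hn
    refine ⟨(d, a, b), ?_, rfl⟩
    simp only [Finset.mem_biUnion, Finset.mem_range, Finset.mem_product, mem_monics,
      mem_coprimePairs]
    exact ⟨d.natDegree, by omega, ⟨hd, rfl⟩, ha, hb, by omega, hab⟩

theorem card_monicPairs_add_two (F : Type) [Field F] [Fintype F] (n : ℕ) :
    (monicPairs F (n + 2)).card =
      (coprimePairs F (n + 2)).card + Fintype.card F * (monicPairs F n).card := by
  rw [card_monicPairs_eq_sum_coprimePairs F (n + 2), card_monicPairs_eq_sum_coprimePairs F n,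
    show (n + 2) / 2 = n / 2 + 1 by omega, Finset.sum_range_succ', Finset.mul_sum, add_comm]
  congr 1
  · simp
  · refine Finset.sum_congr rfl fun j _ => ?_
    rw [show n + 2 - 2 * (j + 1) = n - 2 * j by omega, pow_succ]
    ring

theorem card_coprimePairs_of_lt_two (F : Type) [Field F] [Fintype F] {n : ℕ} (hn : n < 2) :
    (coprimePairs F n).card = (monicPairs F n).card := by
  rw [card_monicPairs_eq_sum_coprimePairs, show n / 2 = 0 by omega]
  simp

theorem sum_antidiagonal_succ_mul_succ (n : ℕ) :
    ∑ p ∈ Finset.HasAntidiagonal.antidiagonal n, (p.1 + 1) * (p.2 + 1) = (n + 3).choose 3 := by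
  have hlin (n : ℕ) : ∑ p ∈ Finset.HasAntidiagonal.antidiagonal n,
        (p.2 + 1) = (n + 2).choose 2 := by
    induction n with
    | zero => simp
    | succ n ih =>
      rw [Finset.Nat.sum_antidiagonal_succ, ih, Nat.choose_succ_succ' (n + 2) 1]
      simp
  induction n with
  | zero => simp
  | succ n ih =>
    have hsplit : ∑ p ∈ Finset.HasAntidiagonal.antidiagonal n, (p.1 + 1 + 1) * (p.2 + 1) =
        (n + 3).choose 3 + (n + 2).choose 2 := by
      rw [← ih, ← hlin, ← Finset.sum_add_distrib]
      exact Finset.sum_congr rfl fun p _ => by ring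
    rw [Finset.Nat.sum_antidiagonal_succ, hsplit, Nat.choose_succ_succ' (n + 3) 2,
      Nat.choose_succ_succ' (n + 2) 1]
    simp only [Nat.choose_one_right]
    ring

theorem sum_card_monicPairs_mul (F : Type) [Field F] [Fintype F] (n : ℕ) :
    ∑ p ∈ Finset.HasAntidiagonal.antidiagonal n,
        (monicPairs F p.1).card * (monicPairs F p.2).card =
      (n + 3).choose 3 * Fintype.card F ^ n := by
  rw [← sum_antidiagonal_succ_mul_succ, Finset.sum_mul]
  refine Finset.sum_congr rfl fun p hp => ?_
  rw [card_monicPairs, card_monicPairs, ← Finset.HasAntidiagonal.mem_antidiagonal.1 hp, pow_add]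
  ring

/-- Quadruples `((a, b), (d, c))` of monic polynomials with total degree `n` and `a`, `b`
coprime. -/
noncomputable def coprimeQuadruples (F : Type) [Field F] [Fintype F] (n : ℕ) :
    Finset ((F[X] × F[X]) × (F[X] × F[X])) :=
  gradedProd (coprimePairs F) (monicPairs F) n

theorem mem_coprimeQuadruples {F : Type} [Field F] [Fintype F] {n : ℕ}
    {x : (F[X] × F[X]) × (F[X] × F[X])} :
    x ∈ coprimeQuadruples F n ↔
      (x.1.1.Monic ∧ x.1.2.Monic ∧ IsCoprime x.1.1 x.1.2) ∧ (x.2.1.Monic ∧ x.2.2.Monic) ∧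
        x.1.1.natDegree + x.1.2.natDegree + (x.2.1.natDegree + x.2.2.natDegree) = n := by
  simp only [coprimeQuadruples, mem_gradedProd, mem_coprimePairs, mem_monicPairs]
  constructor
  · rintro ⟨i, j, rfl, ⟨h1, h2, rfl, h3⟩, h4, h5, rfl⟩
    exact ⟨⟨h1, h2, h3⟩, ⟨h4, h5⟩, rfl⟩
  · rintro ⟨⟨h1, h2, h3⟩, ⟨h4, h5⟩, h⟩
    exact ⟨_, _, h, ⟨h1, h2, rfl, h3⟩, h4, h5, rfl⟩

theorem card_coprimeQuadruples (F : Type) [Field F] [Fintype F] (n : ℕ) :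
    (coprimeQuadruples F n).card =
      ∑ p ∈ Finset.HasAntidiagonal.antidiagonal n,
        (coprimePairs F p.1).card * (monicPairs F p.2).card :=
  card_gradedProd _ (fun _ _ _ hi hj =>
    (mem_coprimePairs.1 hi).2.2.1.symm.trans (mem_coprimePairs.1 hj).2.2.1) n

theorem card_coprimeQuadruples_add_two (F : Type) [Field F] [Fintype F] (n : ℕ) :
    (coprimeQuadruples F (n + 2)).card + (n + 3).choose 3 * Fintype.card F ^ (n + 1) =
      (n + 5).choose 3 * Fintype.card F ^ (n + 2) := by
  have h0 := card_coprimePairs_of_lt_two F zero_lt_two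
  have h1 := card_coprimePairs_of_lt_two F one_lt_two
  rw [card_coprimeQuadruples, ← sum_card_monicPairs_mul F (n + 2), pow_succ, ← mul_assoc,
    ← sum_card_monicPairs_mul F n]
  simp only [Finset.Nat.sum_antidiagonal_succ, zero_add, h0, h1, add_assoc, one_add_one_eq_two,
    card_monicPairs_add_two F, add_mul, Finset.sum_add_distrib, Finset.sum_mul]
  congr 3
  refine Finset.sum_congr rfl fun p _ => ?_
  ring

theorem card_coprimeQuadruples_of_lt_two (F : Type) [Field F] [Fintype F] {n : ℕ} (hn : n < 2) :
    (coprimeQuadruples F n).card = (n + 3).choose 3 * Fintype.card F ^ n := by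
  rw [card_coprimeQuadruples, ← sum_card_monicPairs_mul]
  refine Finset.sum_congr rfl fun p hp => ?_
  have := Finset.HasAntidiagonal.mem_antidiagonal.1 hp
  rw [card_coprimePairs_of_lt_two F (by omega)]

theorem dd_sq_eq_card_fiber {F : Type} [Field F] [Fintype F] [DecidableEq F[X]] {f : F[X]}
    (hf : f.Monic) :
    dd f ^ 2 = ((coprimeQuadruples F f.natDegree).filter
      fun x => x.2.1 * x.1.1 * x.1.2 * x.2.2 = f).card := by
  rw [dd, sq, ← Nat.card_prod, ← Nat.card_eq_finsetCard]
  symm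
  let φ : {x // x ∈ (coprimeQuadruples F f.natDegree).filter
      fun x => x.2.1 * x.1.1 * x.1.2 * x.2.2 = f} →
      {g : F[X] // g.Monic ∧ g ∣ f} × {g : F[X] // g.Monic ∧ g ∣ f} := fun x =>
    have hx := Finset.mem_filter.1 x.2
    have hm := mem_coprimeQuadruples.1 hx.1
    (⟨x.1.2.1 * x.1.1.1, hm.2.1.1.mul hm.1.1, x.1.1.2 * x.1.2.2, hx.2.symm.trans (by ring)⟩,
      ⟨x.1.2.1 * x.1.1.2, hm.2.1.1.mul hm.1.2.1, x.1.1.1 * x.1.2.2, hx.2.symm.trans (by ring)⟩)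
  refine Nat.card_congr (Equiv.ofBijective φ ⟨?_, ?_⟩)
  · rintro ⟨⟨⟨a, b⟩, d, c⟩, hx⟩ ⟨⟨⟨a', b'⟩, d', c'⟩, hx'⟩ h
    simp only [φ, Prod.mk.injEq, Subtype.mk.injEq] at h
    simp only [Finset.mem_filter, mem_coprimeQuadruples] at hx hx'
    obtain ⟨⟨⟨ha, hb, hab⟩, ⟨hd, -⟩, -⟩, he⟩ := hx
    obtain ⟨⟨⟨-, -, hab'⟩, ⟨hd', -⟩, -⟩, he'⟩ := hx'
    obtain ⟨rfl, rfl, rfl⟩ := monic_gcd_decomposition_unique hd hd' hab hab' h.1 h.2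
    have hc : c = c' := mul_left_cancel₀ ((hd.mul ha).mul hb).ne_zero (he.trans he'.symm)
    rw [Subtype.mk.injEq, hc]
  · rintro ⟨⟨g, hg, hgf⟩, ⟨h, hh, hhf⟩⟩
    obtain ⟨d, a, b, hd, ha, hb, hab, rfl, rfl⟩ := exists_monic_gcd_decomposition hg hh
    obtain ⟨k, rfl⟩ := hgf
    rw [mul_assoc] at hhf
    obtain ⟨c, rfl⟩ := hab.symm.dvd_of_dvd_mul_left ((mul_dvd_mul_iff_left hd.ne_zero).1 hhf)
    have hc : c.Monic := hb.of_mul_monic_left (hg.of_mul_monic_left hf)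
    refine ⟨⟨((a, b), (d, c)), ?_⟩, rfl⟩
    simp only [Finset.mem_filter, mem_coprimeQuadruples, hg.natDegree_mul (hb.mul hc),
      hd.natDegree_mul ha, hb.natDegree_mul hc]
    exact ⟨⟨⟨ha, hb, hab⟩, ⟨hd, hc⟩, by ring⟩, by ring⟩

theorem sum_dd_sq_eq_card (F : Type) [Field F] [Fintype F] (n : ℕ) :
    ∑ a : Fin n → F, dd (mon n a) ^ 2 = (coprimeQuadruples F n).card := by
  classical
  have hmap : ∀ x ∈ coprimeQuadruples F n, x.2.1 * x.1.1 * x.1.2 * x.2.2 ∈ monics F n := by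
    intro x hx
    obtain ⟨⟨ha, hb, -⟩, ⟨hd, hc⟩, rfl⟩ := mem_coprimeQuadruples.1 hx
    refine mem_monics.2 ⟨((hd.mul ha).mul hb).mul hc, ?_⟩
    rw [((hd.mul ha).mul hb).natDegree_mul hc, (hd.mul ha).natDegree_mul hb, hd.natDegree_mul ha]
    ring
  rw [Finset.card_eq_sum_card_fiberwise hmap, monics,
    Finset.sum_image (fun _ _ _ _ h => mon_injective n h)]
  refine Finset.sum_congr rfl fun a _ => ?_
  rw [dd_sq_eq_card_fiber (monic_mon a), natDegree_mon]

/-- Mean square of the divisor function: for every prime power `q` and every `n ≥ 1`,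
`∑_{f ∈ Mₙ} d(f)² = C(n+3,3) qⁿ − C(n+1,3) q^{n−1}`. -/
theorem divisor_mean_square (F : Type) [Field F] [Fintype F] (n : ℕ) (hn : 1 ≤ n) :
    (∑ a : Fin n → F, (dd (mon n a) : ℝ) ^ 2) =
      (Nat.choose (n + 3) 3 : ℝ) * (Fintype.card F : ℝ) ^ n -
        (Nat.choose (n + 1) 3 : ℝ) * (Fintype.card F : ℝ) ^ (n - 1) := by
  have hsum : (∑ a : Fin n → F, (dd (mon n a) : ℝ) ^ 2) = ((coprimeQuadruples F n).card : ℝ) := by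
    rw [← sum_dd_sq_eq_card]
    push_cast
    rfl
  rw [hsum, eq_sub_iff_add_eq]
  obtain ⟨m, rfl⟩ := Nat.exists_eq_add_of_le' hn
  cases m with
  | zero =>
    rw [card_coprimeQuadruples_of_lt_two F (by norm_num)]
    simp
  | succ m =>
    have h := card_coprimeQuadruples_add_two F m
    exact_mod_cast h
end
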